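/- arXiv:1204.2591 — 4 statements merged into one kernel-verified Lean document; each statement's English description precedes it below -/
import Mathlib

section
/- For every x ∈ S̃_{k+1} and every residue i ∈ I, one has i ∈ D_R(x) if and only if CRD(x)_i < CRD(x)_{i+1}. That is, the right descent set of an affine permutation equals the descent set of its right decreasing code. -/
/-- `x : Equiv.Perm ℤ` is an affine permutation in `S̃_{k+1}`: it commutes with
translation by `k+1` and its window sums to `(k+1)(k+2)/2`. -/
def IsAffinePerm (k : ℕ) (x : Equiv.Perm ℤ) : Prop :=
  (∀ i : ℤ, x (i + (k + 1)) = x i + (k + 1)) ∧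
  ∑ i ∈ Finset.Icc (1 : ℤ) (k + 1), x i = (k + 1) * (k + 2) / 2

/-- The underlying function of the simple generator `s_i`. -/
def sAffFun (k : ℕ) (i : ZMod (k + 1)) (j : ℤ) : ℤ :=
  if (j : ZMod (k + 1)) = i then j + 1
  else if (j : ZMod (k + 1)) = i + 1 then j - 1
  else j

theorem sAffFun_invol (k : ℕ) (i : ZMod (k + 1)) (h : ¬ (1 : ZMod (k + 1)) = 0) :
    Function.Involutive (sAffFun k i) := by
  have hne : i + 1 ≠ i := fun hc => h (by
    have h2 : i + 1 = i + 0 := by simpa using hc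
    exact add_left_cancel h2)
  intro j
  by_cases h1 : (j : ZMod (k + 1)) = i
  · have e1 : sAffFun k i j = j + 1 := if_pos h1
    have hj1 : ((j + 1 : ℤ) : ZMod (k + 1)) = i + 1 := by push_cast; rw [h1]
    have e2 : sAffFun k i (j + 1) = j := by
      unfold sAffFun
      rw [if_neg (by rw [hj1]; exact hne), if_pos hj1]
      ring
    rw [e1, e2]
  · by_cases h2 : (j : ZMod (k + 1)) = i + 1
    · have e1 : sAffFun k i j = j - 1 := by unfold sAffFun; rw [if_neg h1, if_pos h2]
      have hj1 : ((j - 1 : ℤ) : ZMod (k + 1)) = i := by push_cast; rw [h2]; ring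
      have e2 : sAffFun k i (j - 1) = j := by
        unfold sAffFun; rw [if_pos hj1]; ring
      rw [e1, e2]
    · have e1 : sAffFun k i j = j := by unfold sAffFun; rw [if_neg h1, if_neg h2]
      rw [e1, e1]

/-- The simple generator `s_i` of the affine symmetric group, as a permutation of `ℤ`:
it interchanges `m(k+1) + ī` and `m(k+1) + ī + 1` for every `m` (when `k ≥ 1`). -/
noncomputable def sAff (k : ℕ) (i : ZMod (k + 1)) : Equiv.Perm ℤ :=
  if h : (1 : ZMod (k + 1)) = 0 then 1 else Function.Involutive.toPerm _ (sAffFun_invol k i h)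

/-- The Coxeter length of `x`: the least number of simple generators whose product is `x`. -/
noncomputable def affLen (k : ℕ) (x : Equiv.Perm ℤ) : ℕ :=
  sInf {n : ℕ | ∃ w : List (ZMod (k + 1)), w.length = n ∧ x = (w.map (sAff k)).prod}

/-- The right descent set `D_R(x) = {i : ℓ(x s_i) < ℓ(x)}`. -/
noncomputable def rightDescents (k : ℕ) (x : Equiv.Perm ℤ) : Set (ZMod (k + 1)) :=
  {i | affLen k (x * sAff k i) < affLen k x}

/-- The cyclic interval `[i,j] = {i, i+1, …, j}` of residues mod `k+1`. -/
def cycInt (k : ℕ) (i j : ZMod (k + 1)) : Finset (ZMod (k + 1)) :=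
  (Finset.range ((j - i).val + 1)).image fun t : ℕ => i + (t : ZMod (k + 1))

/-- A choice of a "gate" residue not belonging to `A` (when `A` is proper). -/
noncomputable def gate (k : ℕ) (A : Finset (ZMod (k + 1))) : ZMod (k + 1) :=
  if h : ∃ g, g ∉ A then h.choose else 0

/-- The cyclically decreasing element `d_A`: the product of the `s_a`, `a ∈ A`, in an
order where `s_{a+1}` occurs to the left of `s_a` whenever `a, a+1 ∈ A`. -/
noncomputable def dElt (k : ℕ) (A : Finset (ZMod (k + 1))) : Equiv.Perm ℤ :=
  (((((List.range (k + 1)).reverse.map fun t : ℕ => gate k A + (t : ZMod (k + 1))).filter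
      fun a => decide (a ∈ A)).map (sAff k)).prod)

/-- The cyclically increasing element `u_A`: the product of the `s_a`, `a ∈ A`, in an
order where `s_{a+1}` occurs to the right of `s_a` whenever `a, a+1 ∈ A`. -/
noncomputable def uElt (k : ℕ) (A : Finset (ZMod (k + 1))) : Equiv.Perm ℤ :=
  ((((List.range (k + 1)).map fun t : ℕ => gate k A + (t : ZMod (k + 1))).filter
      fun a => decide (a ∈ A)).map (sAff k)).prod

/-- The right decreasing code: `CRD(x)_i = #{j < ī : x(j) > x(ī)}`. -/
noncomputable def CRD (k : ℕ) (x : Equiv.Perm ℤ) (i : ZMod (k + 1)) : ℕ :=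
  Set.ncard {j : ℤ | j < (i.val : ℤ) ∧ x (i.val : ℤ) < x j}

/-- The right increasing code: `CRI(x)_i = #{j > ī + 1 : x(j) < x(ī + 1)}`. -/
noncomputable def CRI (k : ℕ) (x : Equiv.Perm ℤ) (i : ZMod (k + 1)) : ℕ :=
  Set.ncard {j : ℤ | (i.val : ℤ) + 1 < j ∧ x j < x ((i.val : ℤ) + 1)}

/-- The left decreasing code: `CLD(x)_i = #{j < x⁻¹(ī + 1) : x(j) > ī + 1}`. -/
noncomputable def CLD (k : ℕ) (x : Equiv.Perm ℤ) (i : ZMod (k + 1)) : ℕ :=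
  Set.ncard {j : ℤ | j < x.symm ((i.val : ℤ) + 1) ∧ (i.val : ℤ) + 1 < x j}

/-- The left increasing code: `CLI(x)_i = #{j > x⁻¹(ī) : x(j) < ī}`. -/
noncomputable def CLI (k : ℕ) (x : Equiv.Perm ℤ) (i : ZMod (k + 1)) : ℕ :=
  Set.ncard {j : ℤ | x.symm ((i.val : ℤ)) < j ∧ x j < (i.val : ℤ)}

namespace AffinePerm

variable {k : ℕ} {x : Equiv.Perm ℤ}

theorem one_ne_zero_zmod (hk : 1 ≤ k) : ¬ (1 : ZMod (k + 1)) = 0 := by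
  have : Fact (1 < k + 1) := ⟨by omega⟩
  exact one_ne_zero

theorem sAff_apply (hk : 1 ≤ k) (i : ZMod (k + 1)) (j : ℤ) : sAff k i j = sAffFun k i j := by
  simp [sAff, one_ne_zero_zmod hk, Function.Involutive.coe_toPerm]

theorem sAff_sAff (hk : 1 ≤ k) (i : ZMod (k + 1)) (j : ℤ) : sAff k i (sAff k i j) = j := by
  rw [sAff_apply hk, sAff_apply hk]
  exact sAffFun_invol k i (one_ne_zero_zmod hk) j

theorem sAff_mul_self (hk : 1 ≤ k) (i : ZMod (k + 1)) : sAff k i * sAff k i = 1 :=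
  Equiv.ext (sAff_sAff hk i)

theorem sAffFun_lt_iff (hk : 1 ≤ k) (i : ZMod (k + 1)) {j q : ℤ}
    (h₁ : (j : ZMod (k + 1)) = i → j + 1 ≠ q) (h₂ : (q : ZMod (k + 1)) = i → q + 1 ≠ j) :
    sAffFun k i j < sAffFun k i q ↔ j < q := by
  have h1 := one_ne_zero_zmod hk
  have shift : ∀ a b : ℤ, a + 1 = b → (b : ZMod (k + 1)) = a + 1 := by
    rintro a b rfl; push_cast; rfl
  have shift2 : ∀ a b : ℤ, a + 2 = b → (b : ZMod (k + 1)) = a + 1 + 1 := by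
    rintro a b rfl; push_cast; ring
  have e0 : j = q → (j : ZMod (k + 1)) = q := by rintro rfl; rfl
  have e1 := shift j q
  have e2 := shift q j
  have e3 := shift2 j q
  have e4 := shift2 q j
  have hne : i + 1 ≠ i := fun h => h1 (by simpa using h)
  unfold sAffFun
  split_ifs <;> grind

theorem apply_add_mul (hx : ∀ i : ℤ, x (i + (k + 1)) = x i + (k + 1)) (i m : ℤ) :
    x (i + m * (k + 1)) = x i + m * (k + 1) := by
  induction m using Int.induction_on with
  | zero => simp
  | succ n ih =>
    have := hx (i + n * (k + 1))
    rw [show i + ((n : ℤ) + 1) * (k + 1) = i + n * (k + 1) + (k + 1) by ring, this, ih]; ring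
  | pred n ih =>
    have := hx (i + (-(n : ℤ) - 1) * (k + 1))
    rw [show i + (-(n : ℤ) - 1) * (k + 1) + (k + 1) = i + -(n : ℤ) * (k + 1) by ring, ih] at this
    linarith

theorem exists_eq_add_mul {p q : ℤ} (h : (p : ZMod (k + 1)) = q) :
    ∃ m : ℤ, q = p + m * (k + 1) := by
  rw [ZMod.intCast_eq_intCast_iff_dvd_sub] at h
  obtain ⟨m, hm⟩ := h
  exact ⟨m, by push_cast at hm; linarith⟩

theorem intCast_val (r : ZMod (k + 1)) : (((r.val : ℕ) : ℤ) : ZMod (k + 1)) = r := by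
  simp

theorem apply_sub_eq (hx : ∀ i : ℤ, x (i + (k + 1)) = x i + (k + 1)) {p q : ℤ}
    (h : (p : ZMod (k + 1)) = q) : x q - q = x p - p := by
  obtain ⟨m, rfl⟩ := exists_eq_add_mul h
  rw [apply_add_mul hx]; ring

/-- The total displacement of `x` over one period. -/
def disp (k : ℕ) (x : Equiv.Perm ℤ) : ℤ := ∑ r : ZMod (k + 1), (x r.val - r.val)

theorem sum_Icc_intCast (f : ZMod (k + 1) → ℤ) :
    ∑ j ∈ Finset.Icc (1 : ℤ) (k + 1), f j = ∑ r, f r := by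
  refine Finset.sum_bij (fun j _ => (j : ZMod (k + 1))) (by simp) ?_ ?_ (by simp)
  · intro a ha b hb h
    obtain ⟨m, rfl⟩ := exists_eq_add_mul h
    simp only [Finset.mem_Icc] at ha hb
    have h1 : m < 1 := by nlinarith
    have h2 : -1 < m := by nlinarith
    obtain rfl : m = 0 := by omega
    simp
  · intro r _
    have := ZMod.val_lt (r - 1)
    refine ⟨(r - 1).val + 1, by simp only [Finset.mem_Icc]; omega, ?_⟩
    push_cast
    simp

theorem sum_Icc_id (k : ℕ) :
    ∑ j ∈ Finset.Icc (1 : ℤ) (k + 1), j = ((k : ℤ) + 1) * (k + 2) / 2 := by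
  have h : ∑ j ∈ Finset.Icc (1 : ℤ) (k + 1), j
      = ∑ j ∈ Finset.Icc (1 : ℤ) (k + 1), ((k : ℤ) + 2 - j) :=
    Finset.sum_nbij' (fun j => (k : ℤ) + 2 - j) (fun j => (k : ℤ) + 2 - j)
      (by simp only [Finset.mem_Icc]; intros; omega)
      (by simp only [Finset.mem_Icc]; intros; omega)
      (by simp) (by simp) (by simp)
  have hc : (((k : ℤ) + 1).toNat : ℤ) = k + 1 := by omega
  rw [Finset.sum_sub_distrib] at h
  simp only [Finset.sum_const, Int.card_Icc, add_sub_cancel_right, nsmul_eq_mul, hc] at h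
  omega

theorem disp_eq_zero (hx : IsAffinePerm k x) : disp k x = 0 := by
  have h := sum_Icc_intCast (k := k) fun r => x r.val - r.val
  rw [disp, ← h, Finset.sum_congr rfl fun j _ => apply_sub_eq hx.1 (p := j)
      (q := (j : ZMod (k + 1)).val) (intCast_val (j : ZMod (k + 1))).symm,
    Finset.sum_sub_distrib, hx.2, sum_Icc_id, sub_self]

theorem intCast_sAff (hk : 1 ≤ k) (i : ZMod (k + 1)) (j : ℤ) :
    ((sAff k i j : ℤ) : ZMod (k + 1)) = Equiv.swap i (i + 1) (j : ZMod (k + 1)) := by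
  rw [sAff_apply hk]
  unfold sAffFun
  split_ifs with h1 h2
  · rw [h1, Equiv.swap_apply_left]; push_cast; rw [h1]
  · rw [h2, Equiv.swap_apply_right]; push_cast; rw [h2]; ring
  · rw [Equiv.swap_apply_of_ne_of_ne h1 h2]

theorem sAff_add (hk : 1 ≤ k) (i : ZMod (k + 1)) (j : ℤ) :
    sAff k i (j + (k + 1)) = sAff k i j + (k + 1) := by
  have h : ((j + (k + 1) : ℤ) : ZMod (k + 1)) = j := by
    have := ZMod.natCast_self (k + 1)
    push_cast at this ⊢
    rw [this, add_zero]
  rw [sAff_apply hk, sAff_apply hk]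
  unfold sAffFun
  rw [h]
  split_ifs <;> ring

theorem mul_sAff_add (hk : 1 ≤ k) (hx : ∀ i : ℤ, x (i + (k + 1)) = x i + (k + 1))
    (i : ZMod (k + 1)) (j : ℤ) : (x * sAff k i) (j + (k + 1)) = (x * sAff k i) j + (k + 1) := by
  simp only [Equiv.Perm.mul_apply, sAff_add hk, hx]

theorem disp_sAff (hk : 1 ≤ k) (i : ZMod (k + 1)) : disp k (sAff k i) = 0 := by
  have hne : i + 1 ≠ i := fun h => one_ne_zero_zmod hk (by simpa using h)
  have h : ∀ r : ZMod (k + 1), sAff k i r.val - r.val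
      = (if r = i then 1 else 0) - (if r = i + 1 then 1 else 0) := by
    intro r
    rw [sAff_apply hk]
    unfold sAffFun
    rw [intCast_val]
    split_ifs with h1 h2 <;> simp_all
  simp only [disp, h, Finset.sum_sub_distrib, Finset.sum_ite_eq', Finset.mem_univ, if_true, sub_self]

theorem disp_mul_sAff (hk : 1 ≤ k) (hx : ∀ i : ℤ, x (i + (k + 1)) = x i + (k + 1))
    (i : ZMod (k + 1)) : disp k (x * sAff k i) = disp k x := by
  have h : ∀ r : ZMod (k + 1), (x * sAff k i) r.val - r.val
      = (x (Equiv.swap i (i + 1) r).val - (Equiv.swap i (i + 1) r).val)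
        + (sAff k i r.val - r.val) := by
    intro r
    have := apply_sub_eq hx (p := sAff k i r.val) (q := (Equiv.swap i (i + 1) r).val)
      (by rw [intCast_sAff hk, intCast_val, intCast_val])
    rw [this, Equiv.Perm.mul_apply]; ring
  have hs := disp_sAff hk i
  unfold disp at hs ⊢
  rw [Finset.sum_congr rfl fun r _ => h r, Finset.sum_add_distrib, hs, add_zero]
  exact Equiv.sum_comp (Equiv.swap i (i + 1)) fun r : ZMod (k + 1) => x r.val - (r.val : ℤ)

theorem finite_inversions (hx : ∀ i : ℤ, x (i + (k + 1)) = x i + (k + 1)) (p : ℤ) :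
    {j : ℤ | j < p ∧ x p < x j}.Finite := by
  obtain ⟨C, hC⟩ : ∃ C : ℤ, ∀ j, x j ≤ j + C := by
    refine ⟨∑ r : ZMod (k + 1), |x r.val - r.val|, fun j => ?_⟩
    have h1 := apply_sub_eq hx (intCast_val (j : ZMod (k + 1)))
    have h2 := Finset.single_le_sum (f := fun r : ZMod (k + 1) => |x r.val - (r.val : ℤ)|)
      (fun r _ => abs_nonneg _) (Finset.mem_univ (j : ZMod (k + 1)))
    have h3 := le_abs_self (x (j : ZMod (k + 1)).val - ((j : ZMod (k + 1)).val : ℤ))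
    linarith
  refine (Set.finite_Ioo (x p - C) p).subset fun j hj => ⟨?_, hj.1⟩
  have := hC j
  linarith [hj.2]

theorem CRD_intCast (hx : ∀ i : ℤ, x (i + (k + 1)) = x i + (k + 1)) (p : ℤ) :
    CRD k x (p : ZMod (k + 1)) = {j : ℤ | j < p ∧ x p < x j}.ncard := by
  obtain ⟨m, hm⟩ := exists_eq_add_mul (intCast_val (p : ZMod (k + 1)))
  unfold CRD
  set v : ℤ := ((p : ZMod (k + 1)).val : ℤ) with hv
  rw [← Set.ncard_image_of_injective _ (add_left_injective (m * ((k : ℤ) + 1)))]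
  congr 1
  ext j
  simp only [Set.mem_image, Set.mem_ofPred_eq]
  constructor
  · rintro ⟨a, ⟨h1, h2⟩, rfl⟩
    rw [hm, apply_add_mul hx, apply_add_mul hx]
    constructor <;> linarith
  · rintro ⟨h1, h2⟩
    refine ⟨j - m * (k + 1), ⟨by linarith, ?_⟩, by ring⟩
    have := apply_add_mul hx (j - m * (k + 1)) m
    rw [sub_add_cancel] at this
    rw [hm, apply_add_mul hx] at h2
    linarith

theorem apply_lt_apply_succ_iff (hx : ∀ i : ℤ, x (i + (k + 1)) = x i + (k + 1)) {p q : ℤ}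
    (h : (p : ZMod (k + 1)) = q) : x p < x (p + 1) ↔ x q < x (q + 1) := by
  have h1 := apply_sub_eq hx h
  have h2 := apply_sub_eq hx (p := p + 1) (q := q + 1) (by push_cast; rw [h])
  constructor <;> intro _ <;> linarith

theorem CRD_succ_le (hx : ∀ i : ℤ, x (i + (k + 1)) = x i + (k + 1)) {p : ℤ}
    (h : x p < x (p + 1)) :
    CRD k x ((p : ZMod (k + 1)) + 1) ≤ CRD k x (p : ZMod (k + 1)) := by
  have e := CRD_intCast hx (p + 1)
  push_cast at e
  rw [e, CRD_intCast hx]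
  refine Set.ncard_le_ncard ?_ (finite_inversions hx p)
  rintro j ⟨h1, h2⟩
  have : j ≠ p := by rintro rfl; exact absurd h2 h.asymm
  exact ⟨by omega, h.trans h2⟩

theorem CRD_mul_sAff (hk : 1 ≤ k) (hx : ∀ i : ℤ, x (i + (k + 1)) = x i + (k + 1)) {p : ℤ}
    (h : x p < x (p + 1)) (q : ZMod (k + 1)) :
    CRD k (x * sAff k p) (Equiv.swap (p : ZMod (k + 1)) (p + 1) q)
      = CRD k x q + if q = p then 1 else 0 := by
  obtain ⟨q, rfl⟩ : ∃ z : ℤ, (z : ZMod (k + 1)) = q := ⟨q.val, intCast_val q⟩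
  rw [← intCast_sAff hk, CRD_intCast (mul_sAff_add hk hx _), CRD_intCast hx,
    ← Set.ncard_image_of_injective _ (sAff k (p : ZMod (k + 1))).injective]
  have himage : sAff k (p : ZMod (k + 1)) '' {j | j < sAff k (p : ZMod (k + 1)) q ∧
      (x * sAff k p) (sAff k (p : ZMod (k + 1)) q) < (x * sAff k (p : ZMod (k + 1))) j}
      = {j | sAffFun k p j < sAffFun k p q ∧ x q < x j} := by
    ext j
    simp only [Set.mem_image, Set.mem_ofPred_eq, Equiv.Perm.mul_apply, sAff_sAff hk,
      ← sAff_apply hk]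
    constructor
    · rintro ⟨a, h, rfl⟩
      rwa [sAff_sAff hk]
    · intro h
      exact ⟨sAff k p j, by rwa [sAff_sAff hk], sAff_sAff hk _ _⟩
  rw [himage]
  have hasc : ∀ z : ℤ, (z : ZMod (k + 1)) = p → x z < x (z + 1) := fun z hz =>
    (apply_lt_apply_succ_iff hx hz).2 h
  have hne : (p : ZMod (k + 1)) + 1 ≠ p := fun h => one_ne_zero_zmod hk (by simpa using h)
  by_cases hq : (q : ZMod (k + 1)) = p
  · rw [if_pos hq, ← Set.ncard_insert_of_notMem (a := q + 1) (by simp) (finite_inversions hx q)]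
    congr 1
    ext j
    simp only [Set.mem_ofPred_eq, Set.mem_insert_iff]
    by_cases hj : j = q + 1
    · subst hj
      simp only [true_or, iff_true]
      refine ⟨?_, hasc q hq⟩
      unfold sAffFun
      push_cast
      rw [hq, if_neg hne, if_pos rfl, if_pos rfl]
      omega
    · rw [sAffFun_lt_iff hk _ (fun hjp hjq => ?_) (fun _ => Ne.symm hj)]
      · simp [hj]
      · apply hne
        rw [← hjq] at hq
        push_cast at hq
        rwa [hjp] at hq
  · rw [if_neg hq, add_zero]
    congr 1
    ext j
    simp only [Set.mem_ofPred_eq]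
    refine and_congr_left fun hlt => sAffFun_lt_iff hk _ (fun hjp hjq => ?_) (fun h => absurd h hq)
    have := hasc j hjp
    rw [hjq] at this
    exact absurd hlt this.asymm

/-- The number of inversions of `x` modulo translation. -/
noncomputable def inv (k : ℕ) (x : Equiv.Perm ℤ) : ℕ := ∑ r : ZMod (k + 1), CRD k x r

theorem inv_mul_sAff_of_lt (hk : 1 ≤ k) (hx : ∀ i : ℤ, x (i + (k + 1)) = x i + (k + 1)) {p : ℤ}
    (h : x p < x (p + 1)) : inv k (x * sAff k p) = inv k x + 1 := by
  unfold inv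
  rw [← Equiv.sum_comp (Equiv.swap (p : ZMod (k + 1)) (p + 1)),
    Finset.sum_congr rfl fun r _ => CRD_mul_sAff hk hx h r, Finset.sum_add_distrib]
  simp

theorem mul_sAff_lt (hk : 1 ≤ k) {p : ℤ} (h : x (p + 1) < x p) :
    (x * sAff k p) p < (x * sAff k p) (p + 1) := by
  simp only [Equiv.Perm.mul_apply, sAff_apply hk]
  simpa [sAffFun, one_ne_zero_zmod hk] using h

theorem inv_mul_sAff_of_gt (hk : 1 ≤ k) (hx : ∀ i : ℤ, x (i + (k + 1)) = x i + (k + 1)) {p : ℤ}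
    (h : x (p + 1) < x p) : inv k (x * sAff k p) + 1 = inv k x := by
  rw [← inv_mul_sAff_of_lt hk (mul_sAff_add hk hx p) (mul_sAff_lt hk h), mul_assoc,
    sAff_mul_self hk, mul_one]

theorem CRD_lt_succ (hk : 1 ≤ k) (hx : ∀ i : ℤ, x (i + (k + 1)) = x i + (k + 1)) {p : ℤ}
    (h : x (p + 1) < x p) : CRD k x p < CRD k x ((p : ZMod (k + 1)) + 1) := by
  have hne : (p : ZMod (k + 1)) + 1 ≠ p := fun h => one_ne_zero_zmod hk (by simpa using h)
  have hy := mul_sAff_add hk hx p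
  have hlt := mul_sAff_lt hk h
  have h0 := CRD_mul_sAff hk hy hlt p
  have h1 := CRD_mul_sAff hk hy hlt (p + 1)
  have h2 := CRD_succ_le hy hlt
  rw [mul_assoc, sAff_mul_self hk, mul_one] at h0 h1
  rw [Equiv.swap_apply_left, if_pos rfl] at h0
  rw [Equiv.swap_apply_right, if_neg hne] at h1
  omega

theorem eq_one_of_forall_lt (hd : disp k x = 0) (h : ∀ p : ℤ, x p < x (p + 1)) : x = 1 := by
  have hmono : StrictMono x := strictMono_int_of_lt_succ h
  have hsucc : ∀ p, x (p + 1) = x p + 1 := by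
    intro p
    obtain ⟨m, hm⟩ := x.surjective (x p + 1)
    have h1 : p < m := hmono.lt_iff_lt.1 (by omega)
    have h2 : x (p + 1) ≤ x m := hmono.monotone (by omega)
    have := h p
    omega
  have hlin : ∀ p, x p = p + x 0 := by
    intro p
    induction p using Int.induction_on with
    | zero => simp
    | succ n ih => rw [hsucc, ih]; ring
    | pred n ih =>
      have := hsucc (-(n : ℤ) - 1)
      rw [sub_add_cancel] at this
      omega
  have h0 : x 0 = 0 := by
    have hc : disp k x = ∑ _r : ZMod (k + 1), x 0 :=
      Finset.sum_congr rfl fun r _ => by rw [hlin]; ring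
    rw [hd, Finset.sum_const, Finset.card_univ, ZMod.card, nsmul_eq_mul] at hc
    rcases mul_eq_zero.1 hc.symm with h | h
    · exact absurd h (by positivity)
    · exact h
  ext p
  rw [hlin, h0, add_zero, Equiv.Perm.one_apply]

theorem inv_one (k : ℕ) : inv k 1 = 0 := by
  refine Finset.sum_eq_zero fun r _ => ?_
  unfold CRD
  convert Set.ncard_empty ℤ
  ext j
  simp only [Equiv.Perm.one_apply, Set.mem_ofPred_eq, Set.mem_empty_iff_false, iff_false]
  omega

theorem inv_mul_sAff_le (hk : 1 ≤ k) (hx : ∀ i : ℤ, x (i + (k + 1)) = x i + (k + 1))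
    (i : ZMod (k + 1)) : inv k (x * sAff k i) ≤ inv k x + 1 := by
  rw [← intCast_val i]
  rcases lt_or_gt_of_ne (x.injective.ne (show (i.val : ℤ) ≠ i.val + 1 by omega)) with h | h
  · exact (inv_mul_sAff_of_lt hk hx h).le
  · have := inv_mul_sAff_of_gt hk hx h
    omega

theorem inv_prod_le (hk : 1 ≤ k) (w : List (ZMod (k + 1))) :
    (∀ i : ℤ, (w.map (sAff k)).prod (i + (k + 1)) = (w.map (sAff k)).prod i + (k + 1)) ∧
      inv k (w.map (sAff k)).prod ≤ w.length := by
  induction w using List.reverseRecOn with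
  | nil => simp [inv_one]
  | append_singleton w a ih =>
    simp only [List.map_append, List.map_cons, List.map_nil, List.prod_append, List.prod_singleton,
      List.length_append, List.length_singleton]
    exact ⟨mul_sAff_add hk ih.1 a, (inv_mul_sAff_le hk ih.1 a).trans (by omega)⟩

theorem exists_word (hk : 1 ≤ k) (n : ℕ) (hx : ∀ i : ℤ, x (i + (k + 1)) = x i + (k + 1))
    (hd : disp k x = 0) (hn : inv k x = n) :
    ∃ w : List (ZMod (k + 1)), w.length = n ∧ x = (w.map (sAff k)).prod := by
  induction n generalizing x with
  | zero =>
    refine ⟨[], rfl, eq_one_of_forall_lt hd fun p => ?_⟩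
    by_contra h
    have h' := lt_of_le_of_ne (not_lt.1 h) (x.injective.ne (by omega))
    have := inv_mul_sAff_of_gt hk hx h'
    omega
  | succ n ih =>
    obtain ⟨p, hp⟩ : ∃ p, ¬ x p < x (p + 1) := by
      by_contra! h
      rw [eq_one_of_forall_lt hd h, inv_one] at hn
      omega
    have hp' := lt_of_le_of_ne (not_lt.1 hp) (x.injective.ne (by omega))
    have hinv := inv_mul_sAff_of_gt hk hx hp'
    obtain ⟨w, hw, hprod⟩ := ih (mul_sAff_add hk hx p) (by rw [disp_mul_sAff hk hx, hd])
      (by omega)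
    refine ⟨w ++ [(p : ZMod (k + 1))], by simp [hw], ?_⟩
    rw [List.map_append, List.prod_append, ← hprod, List.map_singleton, List.prod_singleton,
      mul_assoc, sAff_mul_self hk, mul_one]

/-- The Coxeter length is the number of inversions. -/
theorem affLen_eq_inv (hk : 1 ≤ k) (hx : ∀ i : ℤ, x (i + (k + 1)) = x i + (k + 1))
    (hd : disp k x = 0) : affLen k x = inv k x := by
  refine le_antisymm (Nat.sInf_le (exists_word hk _ hx hd rfl)) ?_
  refine le_csInf ⟨_, exists_word hk _ hx hd rfl⟩ ?_
  rintro n ⟨w, rfl, rfl⟩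
  exact (inv_prod_le hk w).2

end AffinePerm

open AffinePerm in
/-- right descents of `x` are exactly the descents of `CRD(x)`. -/
theorem right_descent_iff_code_descent (k : ℕ) (hk : 1 ≤ k) (x : Equiv.Perm ℤ)
    (hx : IsAffinePerm k x) (i : ZMod (k + 1)) :
    i ∈ rightDescents k x ↔ CRD k x i < CRD k x (i + 1) := by
  have hd := disp_eq_zero hx
  rw [rightDescents, Set.mem_ofPred_eq, affLen_eq_inv hk hx.1 hd,
    affLen_eq_inv hk (mul_sAff_add hk hx.1 i) (by rw [disp_mul_sAff hk hx.1, hd]),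
    ← intCast_val i]
  rcases lt_or_gt_of_ne (x.injective.ne (show (i.val : ℤ) ≠ i.val + 1 by omega)) with h | h
  · rw [inv_mul_sAff_of_lt hk hx.1 h]
    have := CRD_succ_le hx.1 h
    constructor <;> intro <;> omega
  · have h1 := inv_mul_sAff_of_gt hk hx.1 h
    exact iff_of_true (by omega) (CRD_lt_succ hk hx.1 h)
end

section
/- For every x ∈ S̃_{k+1}, the left decreasing code is a permutation of the right decreasing code, and the left increasing code is a permutation of the right increasing code: there exist bijections π, τ : I → I such that CLD(x)_i = CRD(x)_{π(i)} and CLI(x)_i = CRI(x)_{τ(i)} for all i ∈ I. -/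
theorem Function.Periodic.eq_of_intCast_zmod_eq {α : Type*} {k : ℕ} {f : ℤ → α}
    (hf : Function.Periodic f ((k : ℤ) + 1)) {a b : ℤ}
    (h : (a : ZMod (k + 1)) = (b : ZMod (k + 1))) : f a = f b := by
  rw [ZMod.intCast_eq_intCast_iff_dvd_sub] at h
  obtain ⟨t, ht⟩ := h
  obtain rfl : b = a + t * ((k : ℤ) + 1) := by push_cast at ht; linarith
  exact (hf.int_mul t a).symm

theorem Function.Periodic.apply_zmod_val {α : Type*} {k : ℕ} {f : ℤ → α}
    (hf : Function.Periodic f ((k : ℤ) + 1)) (a : ℤ) :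
    f (((a : ZMod (k + 1)).val : ℕ) : ℤ) = f a :=
  hf.eq_of_intCast_zmod_eq (by simp)

theorem periodic_intCast_apply {k : ℕ} {x : ℤ → ℤ}
    (hx : ∀ i : ℤ, x (i + (k + 1)) = x i + (k + 1)) :
    Function.Periodic (fun i => (x i : ZMod (k + 1))) ((k : ℤ) + 1) := by
  intro i
  have h : ((k : ZMod (k + 1)) + 1) = 0 := by exact_mod_cast ZMod.natCast_self (k + 1)
  simp [hx, h]

theorem symm_apply_add_period {k : ℕ} {x : Equiv.Perm ℤ}
    (hx : ∀ i : ℤ, x (i + (k + 1)) = x i + (k + 1)) (i : ℤ) :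
    x.symm (i + (k + 1)) = x.symm i + (k + 1) := by
  rw [Equiv.symm_apply_eq, hx, Equiv.apply_symm_apply]

/-- The permutation of residues induced by a permutation of `ℤ` commuting with translation
by `k + 1`. -/
def residuePerm (k : ℕ) (x : Equiv.Perm ℤ) (hx : ∀ i : ℤ, x (i + (k + 1)) = x i + (k + 1)) :
    Equiv.Perm (ZMod (k + 1)) where
  toFun a := (x a.val : ZMod (k + 1))
  invFun a := (x.symm a.val : ZMod (k + 1))
  left_inv a := by
    refine ((periodic_intCast_apply (symm_apply_add_period hx)).apply_zmod_val (x a.val)).trans ?_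
    simp
  right_inv a := by
    refine ((periodic_intCast_apply hx).apply_zmod_val (x.symm a.val)).trans ?_
    simp

theorem residuePerm_intCast {k : ℕ} {x : Equiv.Perm ℤ}
    (hx : ∀ i : ℤ, x (i + (k + 1)) = x i + (k + 1)) (a : ℤ) :
    residuePerm k x hx (a : ZMod (k + 1)) = (x a : ZMod (k + 1)) :=
  (periodic_intCast_apply hx).apply_zmod_val a

theorem periodic_ncard_of_translation_invariant {n : ℤ} {r : ℤ → ℤ → Prop}
    (hr : ∀ j m, r (j + n) (m + n) ↔ r j m) :
    Function.Periodic (fun m : ℤ => Set.ncard {j : ℤ | r j m}) n := by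
  intro m
  refine (Set.ncard_congr (fun j _ => j + n) (fun j hj => (hr j m).2 hj)
    (fun a b _ _ h => add_right_cancel h) fun j hj => ?_).symm
  exact ⟨j - n, (hr (j - n) m).1 ((sub_add_cancel j n).symm ▸ hj), sub_add_cancel j n⟩

theorem periodic_ncard_left_inversions {k : ℕ} {x : Equiv.Perm ℤ}
    (hx : ∀ i : ℤ, x (i + (k + 1)) = x i + (k + 1)) :
    Function.Periodic (fun m : ℤ => Set.ncard {j : ℤ | j < m ∧ x m < x j}) ((k : ℤ) + 1) :=
  periodic_ncard_of_translation_invariant (r := fun j m => j < m ∧ x m < x j) fun j m => by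
    simp only [hx, add_lt_add_iff_right]

theorem periodic_ncard_right_inversions {k : ℕ} {x : Equiv.Perm ℤ}
    (hx : ∀ i : ℤ, x (i + (k + 1)) = x i + (k + 1)) :
    Function.Periodic (fun m : ℤ => Set.ncard {j : ℤ | m < j ∧ x j < x m}) ((k : ℤ) + 1) :=
  periodic_ncard_of_translation_invariant (r := fun j m => m < j ∧ x j < x m) fun j m => by
    simp only [hx, add_lt_add_iff_right]

/-- `CLD(x)` is a permutation of `CRD(x)` and `CLI(x)` is a
permutation of `CRI(x)`. -/
theorem left_codes_are_permutations_of_right (k : ℕ) (hk : 1 ≤ k) (x : Equiv.Perm ℤ)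
    (hx : IsAffinePerm k x) :
    (∃ π : Equiv.Perm (ZMod (k + 1)), ∀ i, CLD k x i = CRD k x (π i)) ∧
    (∃ τ : Equiv.Perm (ZMod (k + 1)), ∀ i, CLI k x i = CRI k x (τ i)) := by
  obtain ⟨hx, -⟩ := hx
  have hy := symm_apply_add_period hx
  refine ⟨⟨(Equiv.addRight 1).trans (residuePerm k x.symm hy), fun i => ?_⟩,
    ⟨(residuePerm k x.symm hy).trans (Equiv.subRight 1), fun i => ?_⟩⟩
  · have hi : (Equiv.addRight 1).trans (residuePerm k x.symm hy) i =
        (x.symm ((i.val : ℤ) + 1) : ZMod (k + 1)) := by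
      rw [← residuePerm_intCast hy]
      simp
    have h := (periodic_ncard_left_inversions hx).apply_zmod_val (x.symm ((i.val : ℤ) + 1))
    simp only [Equiv.apply_symm_apply] at h
    rw [hi, CLD, CRD, h]
  · have h := (periodic_ncard_right_inversions hx).eq_of_intCast_zmod_eq
      (a := (((residuePerm k x.symm hy).trans (Equiv.subRight 1) i).val : ℤ) + 1)
      (b := x.symm (i.val : ℤ)) (by simp [residuePerm])
    simp only [Equiv.apply_symm_apply] at h
    rw [CLI, CRI, h]
end

section
/- Let x, y ∈ S̃_{k+1} with ℓ(xy) = ℓ(x) + ℓ(y). Then CRD(y)_i ≤ CRD(xy)_i for every i ∈ I; that is, the right decreasing code of y is contained entrywise in the right decreasing code of xy. -/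
theorem zmod_one_ne_zero {k : ℕ} (hk : 1 ≤ k) : ¬ (1 : ZMod (k + 1)) = 0 := by
  have : Fact (1 < k + 1) := ⟨by omega⟩
  exact one_ne_zero

theorem sAff_apply {k : ℕ} (hk : 1 ≤ k) (i : ZMod (k + 1)) (j : ℤ) :
    sAff k i j = sAffFun k i j := by
  rw [sAff, dif_neg (zmod_one_ne_zero hk)]
  rfl

theorem sAff_mul_self {k : ℕ} (hk : 1 ≤ k) (i : ZMod (k + 1)) : sAff k i * sAff k i = 1 := by
  ext j
  simp only [Equiv.Perm.mul_apply, sAff_apply hk, Equiv.Perm.one_apply]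
  exact sAffFun_invol k i (zmod_one_ne_zero hk) j

theorem sAff_mul_cancel_left {k : ℕ} (hk : 1 ≤ k) (i : ZMod (k + 1)) (x : Equiv.Perm ℤ) :
    sAff k i * (sAff k i * x) = x := by
  rw [← mul_assoc, sAff_mul_self hk, one_mul]

/-- `x` commutes with translation by every multiple of `k + 1`. -/
def IsTranslationEquivariant (k : ℕ) (x : Equiv.Perm ℤ) : Prop :=
  ∀ j m : ℤ, x (j + m * (k + 1)) = x j + m * (k + 1)

theorem intCast_add_mul_period (k : ℕ) (j m : ℤ) :
    ((j + m * (k + 1) : ℤ) : ZMod (k + 1)) = (j : ZMod (k + 1)) := by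
  have h : ((k : ZMod (k + 1)) + 1) = 0 := by exact_mod_cast ZMod.natCast_self (k + 1)
  push_cast
  rw [h, mul_zero, add_zero]

theorem exists_eq_add_mul_period {k : ℕ} {p q : ℤ} (h : (p : ZMod (k + 1)) = q) :
    ∃ m : ℤ, p = q + m * (k + 1) := by
  obtain ⟨m, hm⟩ := (ZMod.intCast_eq_intCast_iff_dvd_sub q p (k + 1)).1 h.symm
  refine ⟨m, ?_⟩
  push_cast at hm
  linarith

theorem sAff_equivariant {k : ℕ} (hk : 1 ≤ k) (i : ZMod (k + 1)) :
    IsTranslationEquivariant k (sAff k i) := by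
  intro j m
  simp only [sAff_apply hk, sAffFun, intCast_add_mul_period]
  split_ifs <;> ring

theorem IsTranslationEquivariant.mul {k : ℕ} {x y : Equiv.Perm ℤ}
    (hx : IsTranslationEquivariant k x) (hy : IsTranslationEquivariant k y) :
    IsTranslationEquivariant k (x * y) := fun j m => by
  rw [Equiv.Perm.mul_apply, hy, hx, Equiv.Perm.mul_apply]

theorem IsTranslationEquivariant.mul_sAff {k : ℕ} (hk : 1 ≤ k) {g : Equiv.Perm ℤ}
    (hg : IsTranslationEquivariant k g) {a : ℤ} (ha : g (a + 1) = g a + 1) :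
    g * sAff k (a : ZMod (k + 1)) = sAff k (g a : ZMod (k + 1)) * g := by
  have key : ∀ j c : ℤ, ((g j : ZMod (k + 1)) = (g c : ZMod (k + 1))) ↔
      (j : ZMod (k + 1)) = (c : ZMod (k + 1)) := by
    intro j c
    constructor
    · intro h
      obtain ⟨m, hm⟩ := exists_eq_add_mul_period h
      rw [← hg] at hm
      rw [g.injective hm, intCast_add_mul_period]
    · intro h
      obtain ⟨m, rfl⟩ := exists_eq_add_mul_period h
      rw [hg, intCast_add_mul_period]
  have h1 : ∀ j : ℤ, ((g j : ZMod (k + 1)) = (g a : ZMod (k + 1)) + 1) ↔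
      (j : ZMod (k + 1)) = (a : ZMod (k + 1)) + 1 := by
    intro j
    have := key j (a + 1)
    rw [ha] at this
    push_cast at this
    exact this
  ext j
  simp only [Equiv.Perm.mul_apply, sAff_apply hk, sAffFun, key, h1]
  split_ifs with h h'
  · obtain ⟨m, rfl⟩ := exists_eq_add_mul_period h
    rw [show a + m * (k + 1) + 1 = (a + 1) + m * ((k : ℤ) + 1) by ring, hg, hg, ha]
    ring
  · obtain ⟨m, rfl⟩ := exists_eq_add_mul_period (p := j) (q := a + 1) (by push_cast; exact h')
    rw [show a + 1 + m * ((k : ℤ) + 1) - 1 = a + m * ((k : ℤ) + 1) by ring, hg, hg, ha]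
    ring
  · rfl

/-- A simple generator reverses the order of two integers only if they are
consecutive and interchanged. -/
theorem sAff_lt_or_eq {k : ℕ} (hk : 1 ≤ k) (i : ZMod (k + 1)) {p q : ℤ} (hpq : p < q) :
    sAff k i p < sAff k i q ∨ (i = (p : ZMod (k + 1)) ∧ q = p + 1) := by
  by_contra! hcon
  obtain ⟨hle, h⟩ := hcon
  have hne : sAff k i p ≠ sAff k i q := fun h' => hpq.ne ((sAff k i).injective h')
  have hlt := lt_of_le_of_ne hle hne.symm
  simp only [sAff_apply hk, sAffFun] at hlt
  split_ifs at hlt <;>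
    first
    | omega
    | exact h (Eq.symm ‹(p : ZMod (k + 1)) = i›) (by omega)

theorem exchange_of_reflection {k : ℕ} (hk : 1 ≤ k) (a : ℤ) (w : List (ZMod (k + 1))) :
    ∀ g : Equiv.Perm ℤ, IsTranslationEquivariant k g → g a < g (a + 1) →
      (w.map (sAff k)).prod.symm (g (a + 1)) < (w.map (sAff k)).prod.symm (g a) →
      ∃ w' : List (ZMod (k + 1)), w'.length + 1 = w.length ∧
        g * sAff k (a : ZMod (k + 1)) * g⁻¹ * (w.map (sAff k)).prod = (w'.map (sAff k)).prod := by
  induction w with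
  | nil =>
    intro g _ hlt hinv
    simp only [List.map_nil, List.prod_nil] at hinv
    exact absurd hinv (not_lt.2 hlt.le)
  | cons b w ih =>
    intro g hg hlt hinv
    rw [List.map_cons, List.prod_cons] at hinv ⊢
    have hb : (sAff k b)⁻¹ = sAff k b := inv_eq_of_mul_eq_one_left (sAff_mul_self hk b)
    rcases sAff_lt_or_eq hk b hlt with h | ⟨rfl, h⟩
    · have hsymm : ∀ p, (sAff k b * (w.map (sAff k)).prod).symm p =
          (w.map (sAff k)).prod.symm (sAff k b p) := by
        intro p
        change (sAff k b * (w.map (sAff k)).prod)⁻¹ p = _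
        rw [mul_inv_rev, hb]
        rfl
      rw [hsymm, hsymm] at hinv
      obtain ⟨w', hw', hprod⟩ := ih (sAff k b * g) ((sAff_equivariant hk b).mul hg) h hinv
      refine ⟨b :: w', by simp [hw'], ?_⟩
      rw [List.map_cons, List.prod_cons, ← hprod, mul_inv_rev, hb]
      simp only [mul_assoc]
      rw [sAff_mul_cancel_left hk]
    · refine ⟨w, by simp, ?_⟩
      rw [hg.mul_sAff hk h]
      rw [mul_inv_cancel_right]
      exact sAff_mul_cancel_left hk _ _

theorem affLen_le_length {k : ℕ} (w : List (ZMod (k + 1))) :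
    affLen k (w.map (sAff k)).prod ≤ w.length :=
  Nat.sInf_le ⟨w, rfl, rfl⟩

theorem exists_reduced_word {k : ℕ} (w : List (ZMod (k + 1))) :
    ∃ w' : List (ZMod (k + 1)), w'.length = affLen k (w.map (sAff k)).prod ∧
      (w.map (sAff k)).prod = (w'.map (sAff k)).prod :=
  Nat.sInf_mem (s := {n : ℕ | ∃ w' : List (ZMod (k + 1)), w'.length = n ∧
    (w.map (sAff k)).prod = (w'.map (sAff k)).prod}) ⟨_, w, rfl, rfl⟩

theorem affLen_sAff_mul_le {k : ℕ} (b : ZMod (k + 1)) (w : List (ZMod (k + 1))) :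
    affLen k (sAff k b * (w.map (sAff k)).prod) ≤ affLen k (w.map (sAff k)).prod + 1 := by
  obtain ⟨w', hw', h⟩ := exists_reduced_word w
  rw [← hw', h]
  simpa using affLen_le_length (b :: w')

theorem affLen_prod_mul_le {k : ℕ} (w v : List (ZMod (k + 1))) :
    affLen k ((w.map (sAff k)).prod * (v.map (sAff k)).prod) ≤
      w.length + affLen k (v.map (sAff k)).prod := by
  obtain ⟨v', hv', h⟩ := exists_reduced_word v
  rw [← hv', h]
  simpa using affLen_le_length (w ++ v')

theorem inversion_of_affLen_lt_sAff_mul {k : ℕ} (hk : 1 ≤ k) (b : ZMod (k + 1))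
    (w : List (ZMod (k + 1)))
    (hlen : affLen k (w.map (sAff k)).prod < affLen k (sAff k b * (w.map (sAff k)).prod))
    {p q : ℤ} (hpq : p < q) (hinv : (w.map (sAff k)).prod q < (w.map (sAff k)).prod p) :
    sAff k b ((w.map (sAff k)).prod q) < sAff k b ((w.map (sAff k)).prod p) := by
  rcases sAff_lt_or_eq hk b hinv with h | ⟨rfl, h⟩
  · exact h
  · exfalso
    obtain ⟨w', hw', hprod⟩ := exists_reduced_word w
    rw [← hw', hprod] at hlen
    rw [hprod] at h
    obtain ⟨v, hv, hv'⟩ := exchange_of_reflection hk ((w'.map (sAff k)).prod q) w' 1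
      (fun _ _ => rfl) (by simp) (by
        simp only [Equiv.Perm.one_apply]
        rw [← h, Equiv.symm_apply_apply, Equiv.symm_apply_apply]
        exact hpq)
    rw [one_mul, inv_one, mul_one] at hv'
    rw [hv'] at hlen
    have := affLen_le_length v
    omega

theorem inversion_of_reduced_product {k : ℕ} (hk : 1 ≤ k) (v w : List (ZMod (k + 1)))
    (hlen : affLen k ((w.map (sAff k)).prod * (v.map (sAff k)).prod) =
      w.length + affLen k (v.map (sAff k)).prod)
    {p q : ℤ} (hpq : p < q) (hinv : (v.map (sAff k)).prod q < (v.map (sAff k)).prod p) :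
    ((w.map (sAff k)).prod * (v.map (sAff k)).prod) q <
      ((w.map (sAff k)).prod * (v.map (sAff k)).prod) p := by
  induction w with
  | nil => simpa using hinv
  | cons b w ih =>
    have happ : (w.map (sAff k)).prod * (v.map (sAff k)).prod =
        ((w ++ v).map (sAff k)).prod := by simp
    rw [List.map_cons, List.prod_cons, mul_assoc, List.length_cons] at hlen
    have h1 := affLen_sAff_mul_le b (w ++ v)
    have h2 := affLen_prod_mul_le w v
    rw [← happ] at h1
    have h3 := ih (by omega)
    rw [List.map_cons, List.prod_cons, mul_assoc, happ]
    rw [happ] at h3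
    refine inversion_of_affLen_lt_sAff_mul hk b (w ++ v) ?_ hpq h3
    rw [← happ]
    omega

theorem abs_prod_sAff_sub_le {k : ℕ} (hk : 1 ≤ k) (w : List (ZMod (k + 1))) (j : ℤ) :
    |(w.map (sAff k)).prod j - j| ≤ w.length := by
  induction w with
  | nil => simp
  | cons b w ih =>
    rw [List.map_cons, List.prod_cons, Equiv.Perm.mul_apply, sAff_apply hk, sAffFun,
      List.length_cons]
    push_cast
    rw [abs_le] at ih ⊢
    split_ifs <;> constructor <;> linarith [ih.1, ih.2]

/-- A permutation with periodic displacement `d` of total `0` is a product of generators. -/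
theorem exists_word_of_displacement {k : ℕ} (hk : 1 ≤ k) (n : ℕ) :
    ∀ (x : Equiv.Perm ℤ) (d : ZMod (k + 1) → ℤ), (∀ j : ℤ, x j = j + d j) →
      ∑ r, d r = 0 → ∑ r, d r ^ 2 ≤ n →
      ∃ w : List (ZMod (k + 1)), x = (w.map (sAff k)).prod := by
  induction n with
  | zero =>
    intro x d hx _ hsq
    have h0 : ∀ r, d r = 0 := by
      intro r
      have h := Finset.single_le_sum (f := fun r => d r ^ 2) (fun r _ => sq_nonneg (d r))
        (Finset.mem_univ r)
      have h' : d r ^ 2 = 0 := le_antisymm (h.trans (by exact_mod_cast hsq)) (sq_nonneg _)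
      exact pow_eq_zero_iff (two_ne_zero) |>.1 h'
    refine ⟨[], ?_⟩
    ext j
    simp [hx, h0]
  | succ n ih =>
    intro x d hx hsum hsq
    by_cases hdesc : ∀ i, d i ≤ d (i + 1)
    · have hshift : ∑ r, d (r + 1) = ∑ r, d r := Equiv.sum_comp (Equiv.addRight (1 : ZMod (k + 1))) d
      have heq := (Finset.sum_eq_sum_iff_of_le (s := Finset.univ) fun i _ => hdesc i).1 hshift.symm
      have hconst : ∀ m : ℕ, d m = d 0 := by
        intro m
        induction m with
        | zero => simp
        | succ m ihm => rw [Nat.cast_succ, ← heq _ (Finset.mem_univ _), ihm]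
      have hc : ∀ r, d r = d 0 := fun r => by
        rw [← hconst r.val, ZMod.natCast_zmod_val]
      have hd0 : d 0 = 0 := by
        rw [Finset.sum_congr rfl fun r _ => hc r] at hsum
        simp only [Finset.sum_const, Finset.card_univ, ZMod.card, nsmul_eq_mul] at hsum
        rcases mul_eq_zero.1 hsum with h | h
        · exact absurd h (by positivity)
        · exact h
      refine ⟨[], ?_⟩
      ext j
      simp [hx, hc, hd0]
    · push Not at hdesc
      obtain ⟨i, hi⟩ := hdesc
      have hne : i + 1 ≠ i := fun h => zmod_one_ne_zero hk (by simpa using h)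
      have hi' : d (i + 1) + 1 < d i := by
        refine lt_of_le_of_ne hi fun h => ?_
        have hxi := hx (i.val : ℤ)
        have hxi1 := hx ((i.val : ℤ) + 1)
        push_cast at hxi hxi1
        rw [ZMod.natCast_zmod_val] at hxi hxi1
        have : x (i.val : ℤ) = x ((i.val : ℤ) + 1) := by rw [hxi, hxi1]; linarith
        have := x.injective this
        omega
      set e : ZMod (k + 1) → ℤ :=
        fun r => if r = i then d (i + 1) + 1 else if r = i + 1 then d i - 1 else d r with he
      have split : ∀ f : ZMod (k + 1) → ℤ,
          ∑ r, f r = f i + (f (i + 1) + ∑ r ∈ (Finset.univ.erase i).erase (i + 1), f r) := by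
        intro f
        rw [Finset.add_sum_erase _ f (by simp [hne]), Finset.add_sum_erase _ f (by simp)]
      have hrest : ∀ r ∈ (Finset.univ.erase i).erase (i + 1), e r = d r := by
        intro r hr
        simp only [Finset.mem_erase, Finset.mem_univ, and_true] at hr
        simp [he, hr.1, hr.2]
      have hei : e i = d (i + 1) + 1 := by simp [he]
      have hei1 : e (i + 1) = d i - 1 := by simp [he, hne]
      obtain ⟨w, hw⟩ := ih (x * sAff k i) e
        (by
          intro j
          rw [Equiv.Perm.mul_apply, sAff_apply hk, sAffFun]
          simp only [he]
          split_ifs with h h'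
          · rw [hx]; push_cast; rw [h]; ring
          · rw [hx]; push_cast; rw [h']; simp only [add_sub_cancel_right]; ring
          · rw [hx])
        (by
          rw [split, Finset.sum_congr rfl hrest, hei, hei1, ← hsum, split d]
          ring)
        (by
          rw [split, Finset.sum_congr rfl fun r hr => by rw [hrest r hr], hei, hei1]
          rw [split] at hsq
          push_cast at hsq
          nlinarith)
      refine ⟨w ++ [i], ?_⟩
      rw [List.map_append, List.prod_append, ← hw]
      simp [mul_assoc, sAff_mul_self hk]

theorem sum_Icc_intCast_zmod (k : ℕ) (d : ZMod (k + 1) → ℤ) :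
    ∑ i ∈ Finset.Icc (1 : ℤ) (k + 1), d i = ∑ r, d r := by
  refine Finset.sum_bij' (fun i _ => (i : ZMod (k + 1))) (fun r _ => ((r - 1).val : ℤ) + 1)
    (fun _ _ => Finset.mem_univ _) ?_ ?_ ?_ (fun _ _ => rfl)
  · intro r _
    have := ZMod.val_lt (r - 1)
    rw [Finset.mem_Icc]
    omega
  · intro i hi
    rw [Finset.mem_Icc] at hi
    obtain ⟨m, rfl⟩ : ∃ m : ℕ, i = m + 1 := ⟨(i - 1).toNat, by omega⟩
    push_cast
    rw [add_sub_cancel_right, ZMod.val_natCast, Nat.mod_eq_of_lt (by omega)]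
  · intro r _
    push_cast
    rw [ZMod.natCast_zmod_val, sub_add_cancel]

theorem sum_Icc_id (k : ℕ) :
    ∑ i ∈ Finset.Icc (1 : ℤ) (k + 1), i = (k + 1) * (k + 2) / 2 := by
  have h : ∀ n : ℕ, 2 * ∑ i ∈ Finset.Icc (1 : ℤ) n, i = n * (n + 1) := by
    intro n
    induction n with
    | zero => simp
    | succ n ih =>
      have : Finset.Icc (1 : ℤ) ((n + 1 : ℕ) : ℤ) = insert ((n : ℤ) + 1) (Finset.Icc (1 : ℤ) n) := by
        ext a
        simp only [Finset.mem_Icc, Finset.mem_insert]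
        omega
      rw [this, Finset.sum_insert (by simp), mul_add, ih]
      push_cast
      ring
  have h' := h (k + 1)
  push_cast at h'
  symm
  apply Int.ediv_eq_of_eq_mul_right two_ne_zero
  rw [h']
  ring

theorem IsAffinePerm.exists_word {k : ℕ} (hk : 1 ≤ k) {x : Equiv.Perm ℤ} (hx : IsAffinePerm k x) :
    ∃ w : List (ZMod (k + 1)), x = (w.map (sAff k)).prod := by
  have hper : Function.Periodic (fun j => x j - j) ((k : ℤ) + 1) := fun j => by
    simp only [hx.1]
    ring
  set d : ZMod (k + 1) → ℤ := fun r => x (r.val : ℤ) - r.val with hd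
  have hxd : ∀ j : ℤ, x j = j + d j := by
    intro j
    obtain ⟨m, hm⟩ := exists_eq_add_mul_period (k := k) (p := j)
      (q := ((j : ZMod (k + 1)).val : ℤ)) (by simp)
    have h := hper.int_mul m ((j : ZMod (k + 1)).val : ℤ)
    simp only [Int.cast_id, ← hm] at h
    simp only [hd]
    linarith
  refine exists_word_of_displacement hk (∑ r, d r ^ 2).toNat x d hxd ?_ (Int.self_le_toNat _)
  have h := hx.2
  rw [Finset.sum_congr rfl fun i _ => hxd i, Finset.sum_add_distrib, sum_Icc_id,
    sum_Icc_intCast_zmod] at h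
  linarith

/-- if `ℓ(xy) = ℓ(x) + ℓ(y)` then `CRD(y) ≤ CRD(xy)` entrywise. -/
theorem crd_monotone_of_reduced_product (k : ℕ) (hk : 1 ≤ k) (x y : Equiv.Perm ℤ)
    (hx : IsAffinePerm k x) (hy : IsAffinePerm k y)
    (hred : affLen k (x * y) = affLen k x + affLen k y) (i : ZMod (k + 1)) :
    CRD k y i ≤ CRD k (x * y) i := by
  obtain ⟨w₀, rfl⟩ := hx.exists_word hk
  obtain ⟨v, rfl⟩ := hy.exists_word hk
  obtain ⟨w, hw, hprod⟩ := exists_reduced_word w₀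
  rw [← hw, hprod] at hred
  rw [hprod]
  refine Set.ncard_le_ncard (fun j hj => ⟨hj.1, ?_⟩) ?_
  · exact inversion_of_reduced_product hk v w hred hj.1 hj.2
  · have hbound := abs_prod_sAff_sub_le hk (w ++ v)
    simp only [List.map_append, List.prod_append] at hbound
    refine (Set.finite_Icc ((i.val : ℤ) - 2 * (w ++ v).length) (i.val : ℤ)).subset ?_
    rintro j ⟨hj, hlt⟩
    have h1 := abs_le.1 (hbound j)
    have h2 := abs_le.1 (hbound i.val)
    exact ⟨by linarith [h1.2, h2.1], hj.le⟩
end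

section
/- Let A, B ⊊ I be proper subsets with |A| + |B| ≥ k + 1, and let i ∈ I. Then ℓ(u_B d_A) = |A| + |B| and D_R(u_B d_A) ⊆ {i} hold if and only if D_R(d_A) ⊆ {i} and D_R(u_B) ⊆ {i − 1}. That is, for |A| + |B| ≥ k + 1, the product u_B d_A is reduced and i-dominant if and only if d_A is i-dominant and u_B is (i−1)-dominant. -/
namespace AffineDominant

theorem one_ne_zero_zmod {k : ℕ} (hk : 1 ≤ k) : (1 : ZMod (k + 1)) ≠ 0 := by
  have : Fact (1 < k + 1) := ⟨by omega⟩
  exact one_ne_zero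

section Generators

variable {k : ℕ}

theorem sAff_apply (hk : 1 ≤ k) (a : ZMod (k + 1)) (j : ℤ) : sAff k a j = sAffFun k a j := by
  unfold sAff
  rw [dif_neg (one_ne_zero_zmod hk)]
  rfl

theorem sAff_of_eq (hk : 1 ≤ k) {a : ZMod (k + 1)} {j : ℤ} (h : (j : ZMod (k + 1)) = a) :
    sAff k a j = j + 1 := by
  rw [sAff_apply hk, sAffFun, if_pos h]

theorem sAff_of_eq_add_one (hk : 1 ≤ k)
    {a : ZMod (k + 1)} {j : ℤ} (h : (j : ZMod (k + 1)) = a + 1) :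
    sAff k a j = j - 1 := by
  rw [sAff_apply hk, sAffFun, if_neg, if_pos h]
  rw [h]
  simpa using one_ne_zero_zmod hk

theorem sAff_of_ne (hk : 1 ≤ k) {a : ZMod (k + 1)} {j : ℤ} (h : (j : ZMod (k + 1)) ≠ a)
    (h' : (j : ZMod (k + 1)) ≠ a + 1) : sAff k a j = j := by
  rw [sAff_apply hk, sAffFun, if_neg h, if_neg h']

theorem sAff_le (hk : 1 ≤ k) (a : ZMod (k + 1)) (j : ℤ) : sAff k a j ≤ j + 1 := by
  rw [sAff_apply hk, sAffFun]
  split_ifs <;> omega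

theorem sAff_le_self (hk : 1 ≤ k) {a : ZMod (k + 1)} {j : ℤ} (h : (j : ZMod (k + 1)) ≠ a) :
    sAff k a j ≤ j := by
  rw [sAff_apply hk, sAffFun, if_neg h]
  split_ifs <;> omega

theorem sub_one_le_sAff (hk : 1 ≤ k) (a : ZMod (k + 1)) (j : ℤ) : j - 1 ≤ sAff k a j := by
  rw [sAff_apply hk, sAffFun]
  split_ifs <;> omega

theorem self_le_sAff (hk : 1 ≤ k) {a : ZMod (k + 1)} {j : ℤ} (h : (j : ZMod (k + 1)) ≠ a + 1) :
    j ≤ sAff k a j := by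
  rw [sAff_apply hk, sAffFun]
  split_ifs <;> omega

theorem sAff_mul_self (hk : 1 ≤ k) (a : ZMod (k + 1)) : sAff k a * sAff k a = 1 := by
  ext j
  rw [Equiv.Perm.mul_apply, sAff_apply hk, sAff_apply hk,
    sAffFun_invol k a (one_ne_zero_zmod hk) j]
  rfl

theorem sAff_add_mul (hk : 1 ≤ k) (a : ZMod (k + 1)) (j c : ℤ) :
    sAff k a (j + (k + 1) * c) = sAff k a j + (k + 1) * c := by
  have e : ((j + (k + 1) * c : ℤ) : ZMod (k + 1)) = j := by
    have : ((k : ZMod (k + 1)) + 1) = 0 := by exact_mod_cast ZMod.natCast_self (k + 1)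
    push_cast
    rw [this]; ring
  rw [sAff_apply hk, sAff_apply hk, sAffFun, sAffFun, e]
  split_ifs <;> ring

end Generators

/-- The product of the simple generators along a word. -/
noncomputable def wordProd (k : ℕ) (L : List (ZMod (k + 1))) : Equiv.Perm ℤ :=
  (L.map (sAff k)).prod

theorem wordProd_nil (k : ℕ) : wordProd k [] = 1 := rfl

theorem wordProd_cons (k : ℕ) (a : ZMod (k + 1)) (L : List (ZMod (k + 1))) :
    wordProd k (a :: L) = sAff k a * wordProd k L := by
  simp [wordProd]

theorem wordProd_append (k : ℕ) (L M : List (ZMod (k + 1))) :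
    wordProd k (L ++ M) = wordProd k L * wordProd k M := by
  simp [wordProd]

theorem wordProd_concat (k : ℕ) (L : List (ZMod (k + 1))) (a : ZMod (k + 1)) :
    wordProd k (L ++ [a]) = wordProd k L * sAff k a := by
  simp [wordProd]

theorem affLen_wordProd_le (k : ℕ) (L : List (ZMod (k + 1))) :
    affLen k (wordProd k L) ≤ L.length :=
  Nat.sInf_le ⟨L, rfl, rfl⟩

theorem exists_reduced_word (k : ℕ) (L : List (ZMod (k + 1))) :
    ∃ M : List (ZMod (k + 1)), M.length = affLen k (wordProd k L) ∧
      wordProd k L = wordProd k M := by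
  have h : ({n : ℕ | ∃ w : List (ZMod (k + 1)), w.length = n ∧
      wordProd k L = (w.map (sAff k)).prod}).Nonempty := ⟨_, L, rfl, rfl⟩
  exact Nat.sInf_mem h

theorem affLen_wordProd_mul_le (k : ℕ) (L M : List (ZMod (k + 1))) :
    affLen k (wordProd k L * wordProd k M) ≤
      affLen k (wordProd k L) + affLen k (wordProd k M) := by
  obtain ⟨L', hL, eL⟩ := exists_reduced_word k L
  obtain ⟨M', hM, eM⟩ := exists_reduced_word k M
  rw [← hL, ← hM, eL, eM, ← wordProd_append, ← List.length_append]
  exact affLen_wordProd_le _ _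

section Exchange

variable {k : ℕ}

theorem wordProd_add_mul (hk : 1 ≤ k) (L : List (ZMod (k + 1))) (j c : ℤ) :
    wordProd k L (j + (k + 1) * c) = wordProd k L j + (k + 1) * c := by
  induction L generalizing j with
  | nil => rfl
  | cons a L ih =>
    rw [wordProd_cons, Equiv.Perm.mul_apply, Equiv.Perm.mul_apply, ih, sAff_add_mul hk]

theorem exists_add_mul_of_cast_eq {z j : ℤ} (h : (z : ZMod (k + 1)) = j) :
    ∃ c : ℤ, z = j + (k + 1) * c := by
  have h' : (((k + 1 : ℕ) : ℤ)) ∣ z - j := by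
    rw [← ZMod.intCast_eq_intCast_iff_dvd_sub]
    exact h.symm
  obtain ⟨c, hc⟩ := h'
  exact ⟨c, by push_cast at hc; linarith⟩

theorem cast_add_mul (j c : ℤ) : ((j + (k + 1) * c : ℤ) : ZMod (k + 1)) = j := by
  have : ((k : ZMod (k + 1)) + 1) = 0 := by exact_mod_cast ZMod.natCast_self (k + 1)
  push_cast
  rw [this]; ring

theorem cast_eq_of_wordProd_cast_eq (hk : 1 ≤ k) (L : List (ZMod (k + 1))) {z j : ℤ}
    (h : (wordProd k L z : ZMod (k + 1)) = wordProd k L j) : (z : ZMod (k + 1)) = j := by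
  obtain ⟨c, hc⟩ := exists_add_mul_of_cast_eq h
  rw [← wordProd_add_mul hk] at hc
  rw [(wordProd k L).injective hc, cast_add_mul]

/-- A word whose product carries the adjacent pair `j, j + 1` to the adjacent pair `r, r + 1`
conjugates the corresponding simple generators into each other. -/
theorem wordProd_mul_sAff (hk : 1 ≤ k) (L : List (ZMod (k + 1))) {j r : ℤ}
    (h : wordProd k L j = r) (h' : wordProd k L (j + 1) = r + 1) :
    wordProd k L * sAff k (j : ZMod (k + 1)) = sAff k (r : ZMod (k + 1)) * wordProd k L := by
  ext z
  rw [Equiv.Perm.mul_apply, Equiv.Perm.mul_apply]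
  by_cases h1 : (z : ZMod (k + 1)) = j
  · rw [sAff_of_eq hk h1]
    obtain ⟨c, rfl⟩ := exists_add_mul_of_cast_eq h1
    rw [show j + (k + 1) * c + 1 = (j + 1) + (k + 1) * c by ring, wordProd_add_mul hk,
      wordProd_add_mul hk, h, h', sAff_of_eq hk (cast_add_mul _ _)]
    ring
  · by_cases h2 : (z : ZMod (k + 1)) = j + 1
    · rw [sAff_of_eq_add_one hk h2]
      obtain ⟨c, rfl⟩ := exists_add_mul_of_cast_eq (j := j + 1) (by push_cast; exact h2)
      rw [show j + 1 + (k + 1) * c - 1 = j + (k + 1) * c by ring, wordProd_add_mul hk,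
        wordProd_add_mul hk, h, h', sAff_of_eq_add_one hk (by rw [cast_add_mul]; push_cast; rfl)]
      ring
    · rw [sAff_of_ne hk h1 h2, sAff_of_ne hk]
      · intro h3
        rw [← h] at h3
        exact h1 (cast_eq_of_wordProd_cast_eq hk L h3)
      · intro h3
        have : (wordProd k L z : ZMod (k + 1)) = wordProd k L (j + 1) := by
          rw [h', h3]; push_cast; rfl
        exact h2 (by simpa using cast_eq_of_wordProd_cast_eq hk L this)

theorem sAff_inversion (hk : 1 ≤ k) {a : ZMod (k + 1)} {p q : ℤ} (hpq : p < q)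
    (h : sAff k a q < sAff k a p) : (p : ZMod (k + 1)) = a ∧ q = p + 1 := by
  have h1 := sAff_le hk a p
  have h2 := sub_one_le_sAff hk a q
  refine ⟨?_, by omega⟩
  by_contra hc
  have := sAff_le_self hk hc
  omega

/-- The exchange property at an adjacent inversion. -/
theorem exists_exchange (hk : 1 ≤ k) (L : List (ZMod (k + 1))) (j : ℤ)
    (h : wordProd k L (j + 1) < wordProd k L j) :
    ∃ M : List (ZMod (k + 1)), M.length + 1 = L.length ∧
      wordProd k L * sAff k (j : ZMod (k + 1)) = wordProd k M := by
  induction L with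
  | nil => simp [wordProd_nil] at h
  | cons a L ih =>
    rcases lt_trichotomy (wordProd k L (j + 1)) (wordProd k L j) with hlt | heq | hgt
    · obtain ⟨M, hM, e⟩ := ih hlt
      exact ⟨a :: M, by simp [hM], by rw [wordProd_cons, wordProd_cons, mul_assoc, e]⟩
    · have := (wordProd k L).injective heq
      omega
    · rw [wordProd_cons, Equiv.Perm.mul_apply, Equiv.Perm.mul_apply] at h
      obtain ⟨h1, h2⟩ := sAff_inversion hk hgt h
      refine ⟨L, by simp, ?_⟩
      rw [wordProd_cons, mul_assoc, wordProd_mul_sAff hk L rfl h2, h1, ← mul_assoc,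
        sAff_mul_self hk, one_mul]

theorem affLen_mul_sAff_lt (hk : 1 ≤ k) (L : List (ZMod (k + 1))) (j : ℤ)
    (h : wordProd k L (j + 1) < wordProd k L j) :
    affLen k (wordProd k L * sAff k (j : ZMod (k + 1))) < affLen k (wordProd k L) := by
  obtain ⟨L', hL, e⟩ := exists_reduced_word k L
  rw [e] at h
  obtain ⟨M, hM, e'⟩ := exists_exchange hk L' j h
  rw [← hL, e, e']
  have := affLen_wordProd_le k M
  omega

theorem affLen_lt_mul_sAff (hk : 1 ≤ k) (L : List (ZMod (k + 1))) (j : ℤ)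
    (h : wordProd k L j < wordProd k L (j + 1)) :
    affLen k (wordProd k L) < affLen k (wordProd k L * sAff k (j : ZMod (k + 1))) := by
  have key := affLen_mul_sAff_lt hk (L ++ [(j : ZMod (k + 1))]) j (by
    rw [wordProd_concat, Equiv.Perm.mul_apply, Equiv.Perm.mul_apply, sAff_of_eq hk rfl,
      sAff_of_eq_add_one hk (by push_cast; rfl)]
    simpa using h)
  rwa [wordProd_concat, mul_assoc, sAff_mul_self hk, mul_one] at key

theorem mem_rightDescents_iff (hk : 1 ≤ k) (L : List (ZMod (k + 1))) (j : ℤ) :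
    (j : ZMod (k + 1)) ∈ rightDescents k (wordProd k L) ↔
      wordProd k L (j + 1) < wordProd k L j := by
  refine ⟨fun h => ?_, affLen_mul_sAff_lt hk L j⟩
  by_contra hc
  have hne : wordProd k L j ≠ wordProd k L (j + 1) := fun e => by
    have := (wordProd k L).injective e
    omega
  exact lt_asymm h (affLen_lt_mul_sAff hk L j (lt_of_le_of_ne (not_lt.mp hc) hne))

end Exchange

/-- A word without repeated letters in which `a + 1` never occurs to the right of `a`. -/
def IsDecreasingWord {k : ℕ} (L : List (ZMod (k + 1))) : Prop :=
  L.Pairwise fun x y => y ≠ x ∧ y ≠ x + 1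

/-- A word without repeated letters in which `a + 1` never occurs to the left of `a`. -/
def IsIncreasingWord {k : ℕ} (L : List (ZMod (k + 1))) : Prop :=
  L.Pairwise fun x y => x ≠ y ∧ x ≠ y + 1

section Words

variable {k : ℕ}

theorem wordProd_of_not_mem (hk : 1 ≤ k)
    (L : List (ZMod (k + 1))) {j : ℤ} (h : (j : ZMod (k + 1)) ∉ L)
    (h' : (j : ZMod (k + 1)) - 1 ∉ L) : wordProd k L j = j := by
  induction L with
  | nil => rfl
  | cons a L ih =>
    simp only [List.mem_cons, not_or] at h h'
    rw [wordProd_cons, Equiv.Perm.mul_apply, ih h.2 h'.2, sAff_of_ne hk h.1]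
    exact fun e => h'.1 (by rw [e]; ring)

theorem wordProd_le_self (hk : 1 ≤ k)
    (L : List (ZMod (k + 1))) {j : ℤ} (h : (j : ZMod (k + 1)) ∉ L) :
    wordProd k L j ≤ j := by
  induction L with
  | nil => exact le_rfl
  | cons a L ih =>
    simp only [List.mem_cons, not_or] at h
    rw [wordProd_cons, Equiv.Perm.mul_apply]
    rcases (ih h.2).lt_or_eq with h1 | h1
    · have := sAff_le hk a (wordProd k L j)
      omega
    · rw [h1]
      exact sAff_le_self hk h.1

theorem self_le_wordProd (hk : 1 ≤ k)
    (L : List (ZMod (k + 1))) {j : ℤ} (h : (j : ZMod (k + 1)) - 1 ∉ L) :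
    j ≤ wordProd k L j := by
  induction L with
  | nil => exact le_rfl
  | cons a L ih =>
    simp only [List.mem_cons, not_or] at h
    rw [wordProd_cons, Equiv.Perm.mul_apply]
    rcases (ih h.2).lt_or_eq with h1 | h1
    · have := sub_one_le_sAff hk a (wordProd k L j)
      omega
    · rw [← h1]
      exact self_le_sAff hk fun e => h.1 (by rw [e]; ring)

theorem IsIncreasingWord.apply_of_mem (hk : 1 ≤ k)
    {L : List (ZMod (k + 1))} (hL : IsIncreasingWord L) {j : ℤ}
    (h : (j : ZMod (k + 1)) ∈ L) : wordProd k L j = j + 1 := by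
  induction L with
  | nil => simp at h
  | cons a L ih =>
    obtain ⟨h1, h2⟩ := List.pairwise_cons.mp hL
    rw [wordProd_cons, Equiv.Perm.mul_apply]
    by_cases hj : (j : ZMod (k + 1)) ∈ L
    · rw [ih h2 hj]
      obtain ⟨h3, h4⟩ := h1 _ hj
      refine sAff_of_ne hk ?_ ?_
      · push_cast; exact h4.symm
      · push_cast; exact fun e => h3 (add_right_cancel e).symm
    · have ha : (j : ZMod (k + 1)) = a := by simpa [hj] using h
      rw [wordProd_of_not_mem hk L hj fun h5 => (h1 _ h5).2 (by rw [ha]; ring), sAff_of_eq hk ha]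

theorem IsDecreasingWord.apply_of_mem (hk : 1 ≤ k)
    {L : List (ZMod (k + 1))} (hL : IsDecreasingWord L) {j : ℤ}
    (h : (j : ZMod (k + 1)) ∈ L) : wordProd k L (j + 1) = j := by
  induction L with
  | nil => simp at h
  | cons a L ih =>
    obtain ⟨h1, h2⟩ := List.pairwise_cons.mp hL
    rw [wordProd_cons, Equiv.Perm.mul_apply]
    by_cases hj : (j : ZMod (k + 1)) ∈ L
    · rw [ih h2 hj]
      exact sAff_of_ne hk (h1 _ hj).1 (h1 _ hj).2
    · have ha : (j : ZMod (k + 1)) = a := by simpa [hj] using h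
      rw [wordProd_of_not_mem hk L, sAff_of_eq_add_one hk]
      · ring
      · push_cast; rw [ha]
      · push_cast; exact fun h5 => (h1 _ h5).2 (by rw [ha])
      · push_cast; simpa using hj

theorem IsIncreasingWord.descent_iff (hk : 1 ≤ k)
    {L : List (ZMod (k + 1))} (hL : IsIncreasingWord L) (j : ℤ) :
    wordProd k L (j + 1) < wordProd k L j ↔
      (j : ZMod (k + 1)) ∈ L ∧ (j : ZMod (k + 1)) + 1 ∉ L := by
  have hne : wordProd k L (j + 1) ≠ wordProd k L j := fun e => by
    have := (wordProd k L).injective e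
    omega
  by_cases h1 : (j : ZMod (k + 1)) ∈ L
  · have e1 := hL.apply_of_mem hk h1
    by_cases h2 : (j : ZMod (k + 1)) + 1 ∈ L
    · have e2 := hL.apply_of_mem hk (j := j + 1) (by push_cast; exact h2)
      simp only [h1, h2, not_true, and_false, iff_false]
      omega
    · have e2 := wordProd_le_self hk L (j := j + 1) (by push_cast; exact h2)
      simp only [h1, h2, not_false_iff, and_true, iff_true]
      omega
  · simp only [h1, false_and, iff_false]
    have e1 := wordProd_le_self hk L h1
    by_cases h2 : (j : ZMod (k + 1)) + 1 ∈ L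
    · have e2 := hL.apply_of_mem hk (j := j + 1) (by push_cast; exact h2)
      omega
    · have e2 := wordProd_of_not_mem hk L (j := j + 1) (by push_cast; exact h2)
        (by push_cast; simpa using h1)
      omega

theorem IsDecreasingWord.descent_iff (hk : 1 ≤ k)
    {L : List (ZMod (k + 1))} (hL : IsDecreasingWord L) (j : ℤ) :
    wordProd k L (j + 1) < wordProd k L j ↔
      (j : ZMod (k + 1)) ∈ L ∧ (j : ZMod (k + 1)) - 1 ∉ L := by
  have hne : wordProd k L (j + 1) ≠ wordProd k L j := fun e => by
    have := (wordProd k L).injective e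
    omega
  by_cases h1 : (j : ZMod (k + 1)) ∈ L
  · have e1 := hL.apply_of_mem hk h1
    by_cases h2 : (j : ZMod (k + 1)) - 1 ∈ L
    · have e2 := hL.apply_of_mem hk (j := j - 1) (by push_cast; exact h2)
      rw [sub_add_cancel] at e2
      simp only [h1, h2, not_true, and_false, iff_false]
      omega
    · have e2 := self_le_wordProd hk L h2
      simp only [h1, h2, not_false_iff, and_true, iff_true]
      omega
  · simp only [h1, false_and, iff_false]
    have e1 := self_le_wordProd hk L (j := j + 1) (by push_cast; simpa using h1)
    by_cases h2 : (j : ZMod (k + 1)) - 1 ∈ L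
    · have e2 := hL.apply_of_mem hk (j := j - 1) (by push_cast; exact h2)
      rw [sub_add_cancel] at e2
      omega
    · have e2 := wordProd_of_not_mem hk L h1 h2
      omega

theorem IsIncreasingWord.length_le_affLen (hk : 1 ≤ k)
    {L : List (ZMod (k + 1))} (hL : IsIncreasingWord L) :
    L.length ≤ affLen k (wordProd k L) := by
  induction L using List.reverseRecOn with
  | nil => simp
  | append_singleton M a ih =>
    obtain ⟨hM, -, hMa⟩ := List.pairwise_append.mp hL
    have hMa : ∀ x ∈ M, x ≠ a ∧ x ≠ a + 1 := fun x hx => hMa x hx a (by simp)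
    obtain ⟨j, rfl⟩ := ZMod.intCast_surjective a
    have haM : (j : ZMod (k + 1)) ∉ M := fun h => (hMa _ h).1 rfl
    have e1 := wordProd_le_self hk M haM
    have e2 := wordProd_of_not_mem hk M (j := j + 1)
      (by push_cast; exact fun h => (hMa _ h).2 rfl) (by push_cast; simpa using haM)
    have := affLen_lt_mul_sAff hk M j (by omega)
    have := ih hM
    rw [wordProd_concat, List.length_append, List.length_singleton]
    omega

/-- A partial product of a decreasing word carries `j + 1`, for the next letter `j`, outside the
set of all letters of the word. -/
theorem IsDecreasingWord.initial_apply_not_mem (hk : 1 ≤ k) (M : List (ZMod (k + 1)))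
    {N : List (ZMod (k + 1))} {j : ℤ}
    (h : IsDecreasingWord (M ++ (j : ZMod (k + 1)) :: N)) :
    (wordProd k M (j + 1) : ZMod (k + 1)) ∉ M ++ (j : ZMod (k + 1)) :: N ∧
      (wordProd k M (j + 1) : ZMod (k + 1)) - 1 ∈ M ++ [(j : ZMod (k + 1))] := by
  induction M with
  | nil =>
    have hj := (List.pairwise_cons.mp h).1
    have : (j : ZMod (k + 1)) + 1 ∉ N := fun hc => (hj _ hc).2 rfl
    simpa [wordProd_nil, one_ne_zero_zmod hk] using this
  | cons b M ih =>
    rw [List.cons_append] at h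
    obtain ⟨h1, h2⟩ := List.pairwise_cons.mp h
    obtain ⟨h3, h4⟩ := ih h2
    rw [wordProd_cons, Equiv.Perm.mul_apply, List.cons_append, List.cons_append]
    set v := wordProd k M (j + 1)
    have hsub : ∀ x ∈ M ++ [(j : ZMod (k + 1))], x ∈ M ++ (j : ZMod (k + 1)) :: N := by
      intro x hx
      simp only [List.mem_append, List.mem_cons, List.not_mem_nil, or_false] at hx ⊢
      tauto
    by_cases hv : (v : ZMod (k + 1)) = b
    · rw [sAff_of_eq hk hv]
      push_cast
      rw [hv]
      refine ⟨?_, by simp⟩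
      rw [List.mem_cons, not_or]
      refine ⟨by simpa using one_ne_zero_zmod hk, fun h5 => (h1 _ h5).2 rfl⟩
    · have hv' : (v : ZMod (k + 1)) ≠ b + 1 := fun e => by
        rw [e, add_sub_cancel_right] at h4
        exact (h1 _ (hsub _ h4)).1 rfl
      rw [sAff_of_ne hk hv hv']
      exact ⟨by rw [List.mem_cons, not_or]; exact ⟨hv, h3⟩, List.mem_cons_of_mem _ h4⟩

theorem IsIncreasingWord.apply_le (hk : 1 ≤ k)
    {U : List (ZMod (k + 1))} (hU : IsIncreasingWord U) (j : ℤ) :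
    wordProd k U j ≤ j + 1 := by
  by_cases h : (j : ZMod (k + 1)) ∈ U
  · exact (hU.apply_of_mem hk h).le
  · have := wordProd_le_self hk U h
    omega

theorem affLen_add_length_le (hk : 1 ≤ k) {U L : List (ZMod (k + 1))} (hU : IsIncreasingWord U)
    (hL : IsDecreasingWord L) (hcover : ∀ x, x ∉ L → x ∈ U) :
    affLen k (wordProd k U) + L.length ≤ affLen k (wordProd k U * wordProd k L) := by
  suffices key : ∀ M N : List (ZMod (k + 1)), L = M ++ N →
      affLen k (wordProd k U) + M.length ≤ affLen k (wordProd k U * wordProd k M) from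
    key L [] (by simp)
  intro M
  induction M using List.reverseRecOn with
  | nil => simp [wordProd_nil]
  | append_singleton M a ih =>
    intro N hMN
    rw [List.append_assoc, List.singleton_append] at hMN
    have hM := ih _ hMN
    obtain ⟨j, rfl⟩ := ZMod.intCast_surjective a
    subst hMN
    obtain ⟨-, -, hMj⟩ := List.pairwise_append.mp hL
    have hMj : ∀ x ∈ M, (j : ZMod (k + 1)) ≠ x ∧ (j : ZMod (k + 1)) ≠ x + 1 :=
      fun x hx => hMj x hx _ (by simp)
    have hjM : (j : ZMod (k + 1)) ∉ M := fun h => (hMj _ h).1 rfl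
    have e1 := wordProd_of_not_mem hk M hjM fun h => (hMj _ h).2 (by ring)
    have e2 := self_le_wordProd hk M (j := j + 1) (by push_cast; simpa using hjM)
    have e3 := hU.apply_of_mem hk
      (hcover _ (IsDecreasingWord.initial_apply_not_mem hk M hL).1)
    have e4 := hU.apply_le hk j
    have key := affLen_lt_mul_sAff hk (U ++ M) j (by
      rw [wordProd_append, Equiv.Perm.mul_apply, Equiv.Perm.mul_apply, e1]
      omega)
    rw [wordProd_append, mul_assoc] at key
    rw [wordProd_concat, List.length_append, List.length_singleton]
    omega

theorem affLen_mul_lt_of_descent (hk : 1 ≤ k) {U L : List (ZMod (k + 1))} {j : ℤ}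
    (hU : wordProd k U (j + 1) < wordProd k U j) (hL : IsDecreasingWord L)
    (hj : (j : ZMod (k + 1)) ∈ L) (hj' : (j : ZMod (k + 1)) + 1 ∉ L) :
    affLen k (wordProd k U * wordProd k L) < U.length + L.length := by
  obtain ⟨V, hV, e⟩ := exists_exchange hk U j hU
  obtain ⟨M, N, rfl⟩ := List.append_of_mem hj
  obtain ⟨-, -, hM⟩ := List.pairwise_append.mp hL
  have hM : ∀ x ∈ M, (j : ZMod (k + 1)) ≠ x ∧ (j : ZMod (k + 1)) ≠ x + 1 :=
    fun x hx => hM x hx _ (by simp)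
  have hjM : (j : ZMod (k + 1)) ∉ M := fun h => (hM _ h).1 rfl
  have e1 := wordProd_of_not_mem hk M hjM fun h => (hM _ h).2 (by ring)
  have e2 := wordProd_of_not_mem hk M (j := j + 1)
    (by push_cast; exact fun h => hj' (by simp [h])) (by push_cast; simpa using hjM)
  have e3 : wordProd k U * wordProd k (M ++ (j : ZMod (k + 1)) :: N) =
      wordProd k (V ++ (M ++ N)) := by
    rw [wordProd_append k M, wordProd_cons, ← mul_assoc (wordProd k M),
      wordProd_mul_sAff hk M e1 e2, wordProd_append, wordProd_append, ← e]
    simp only [mul_assoc]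
  rw [e3]
  have := affLen_wordProd_le k (V ++ (M ++ N))
  simp only [List.length_append, List.length_cons] at this ⊢
  omega

end Words

section Residues

variable {k : ℕ}

/-- A set of residues closed under `y ↦ y - 1` away from `i` is an initial segment of the cyclic
order starting at `i`. -/
theorem mem_of_val_sub_le {S : Set (ZMod (k + 1))} {i : ZMod (k + 1)}
    (hS : ∀ y ∈ S, y ≠ i → y - 1 ∈ S) {x y : ZMod (k + 1)} (hx : x ∈ S)
    (hxy : (y - i).val ≤ (x - i).val) : y ∈ S := by
  have key : ∀ s : ℕ, s ≤ (x - i).val → x - s ∈ S := by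
    intro s
    induction s with
    | zero => simpa using hx
    | succ s ih =>
      intro hs
      have h1 := hS _ (ih (by omega)) fun e => by
        have h2 : x - i = (s : ZMod (k + 1)) := by rw [← e]; ring
        have h3 := ZMod.val_lt (x - i)
        have h4 : s < k + 1 := by omega
        rw [h2, ZMod.val_natCast_of_lt h4] at hs
        omega
      push_cast
      rwa [← sub_sub]
  have := key ((x - i).val - (y - i).val) (by omega)
  rw [Nat.cast_sub hxy, ZMod.natCast_zmod_val, ZMod.natCast_zmod_val] at this
  convert this using 1
  ring

theorem val_neg_one_sub (z : ZMod (k + 1)) : (-1 - z).val = k - z.val := by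
  have h := ZMod.val_lt z
  have h0 : ((k : ZMod (k + 1)) + 1) = 0 := by exact_mod_cast ZMod.natCast_self (k + 1)
  have e : -1 - z = ((k - z.val : ℕ) : ZMod (k + 1)) := by
    rw [Nat.cast_sub (by omega), ZMod.natCast_zmod_val, eq_neg_of_add_eq_zero_left h0]
  rw [e, ZMod.val_natCast_of_lt (by omega)]

theorem mem_of_le_val_sub {S : Set (ZMod (k + 1))} {i : ZMod (k + 1)}
    (hS : ∀ y ∈ S, y ≠ i - 1 → y + 1 ∈ S) {x y : ZMod (k + 1)} (hx : x ∈ S)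
    (hxy : (x - i).val ≤ (y - i).val) : y ∈ S := by
  have h := mem_of_val_sub_le (S := {z | 2 * i - 1 - z ∈ S}) (i := i)
    (x := 2 * i - 1 - x) (y := 2 * i - 1 - y) (fun z hz hzi => by
      have := hS _ hz fun e => hzi (by linear_combination -e)
      rw [Set.mem_ofPred_eq]
      convert this using 1
      ring) (by simpa using hx) (by
      rw [show 2 * i - 1 - y - i = -1 - (y - i) by ring,
        show 2 * i - 1 - x - i = -1 - (x - i) by ring, val_neg_one_sub, val_neg_one_sub]
      omega)
  simpa using h

theorem card_add_card_le {A B : Finset (ZMod (k + 1))} (hAB : Disjoint A B) {j : ZMod (k + 1)}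
    (hA : j ∉ A) (hB : j ∉ B) : A.card + B.card ≤ k := by
  rw [← Finset.card_union_of_disjoint hAB]
  have h : A ∪ B ≠ Finset.univ := fun e => by
    have := Finset.mem_univ j
    rw [← e, Finset.mem_union] at this
    tauto
  have := (Finset.card_lt_iff_ne_univ _).mpr h
  rw [ZMod.card] at this
  omega

/-- An initial segment has at most one upper end. -/
theorem upper_end_unique {A : Finset (ZMod (k + 1))} {i : ZMod (k + 1)} (hi : i ∈ A)
    (hA : ∀ y ∈ A, y ≠ i → y - 1 ∈ A) {x t : ZMod (k + 1)} (hx : x ∈ A) (hx' : x + 1 ∉ A)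
    (ht : t ∈ A) (ht' : t + 1 ∉ A) : x = t := by
  by_contra hne
  have hsub : (A.erase i).image (fun y => y - 1) ⊆ (A.erase x).erase t := by
    intro z hz
    obtain ⟨y, hy, rfl⟩ := Finset.mem_image.mp hz
    rw [Finset.mem_erase] at hy
    rw [Finset.mem_erase, Finset.mem_erase]
    refine ⟨fun e => ht' ?_, fun e => hx' ?_, hA y hy.2 hy.1⟩
    · rw [← e, sub_add_cancel]; exact hy.2
    · rw [← e, sub_add_cancel]; exact hy.2
  have hcard := Finset.card_le_card hsub
  have ht2 : t ∈ A.erase x := Finset.mem_erase.mpr ⟨Ne.symm hne, ht⟩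
  rw [Finset.card_image_of_injective _ (fun a b h => by simpa using h),
    Finset.card_erase_of_mem hi, Finset.card_erase_of_mem ht2, Finset.card_erase_of_mem hx] at hcard
  have h1 : 0 < (A.erase x).card := Finset.card_pos.mpr ⟨t, ht2⟩
  rw [Finset.card_erase_of_mem hx] at h1
  omega

theorem exists_mem_add_one_not_mem {S : Finset (ZMod (k + 1))} (hS : S.Nonempty)
    (hS' : S ≠ Finset.univ) : ∃ x ∈ S, x + 1 ∉ S := by
  by_contra! hc
  obtain ⟨x, hx⟩ := hS
  refine hS' (Finset.eq_univ_iff_forall.mpr fun y => ?_)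
  have key : ∀ s : ℕ, x + s ∈ S := by
    intro s
    induction s with
    | zero => simpa using hx
    | succ s ih =>
      push_cast
      rw [← add_assoc]
      exact hc _ ih
  have := key (y - x).val
  rwa [ZMod.natCast_zmod_val, add_sub_cancel] at this

end Residues

section Elements

variable {k : ℕ}

theorem gate_not_mem {A : Finset (ZMod (k + 1))} (hA : A ≠ Finset.univ) : gate k A ∉ A := by
  have h : ∃ g, g ∉ A := by
    by_contra! hc
    exact hA (Finset.eq_univ_iff_forall.mpr hc)
  rw [gate, dif_pos h]
  exact h.choose_spec

/-- The elements of `A` in cyclic order starting from the gate. -/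
theorem exists_gate_word {A : Finset (ZMod (k + 1))} (hA : A ≠ Finset.univ) :
    let L := ((List.range (k + 1)).map fun t : ℕ => gate k A + (t : ZMod (k + 1))).filter
      fun a => decide (a ∈ A)
    IsIncreasingWord L ∧ L.length = A.card ∧ ∀ x, x ∈ L ↔ x ∈ A := by
  intro L
  have hg := gate_not_mem hA
  have hinc : IsIncreasingWord L := by
    rw [IsIncreasingWord, List.pairwise_filter, List.pairwise_map]
    refine (List.pairwise_lt_range (n := k + 1)).imp_of_mem ?_
    intro s t hs ht hst hsA htA
    rw [List.mem_range] at hs ht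
    refine ⟨fun e => ?_, fun e => ?_⟩
    · have e' : (s : ZMod (k + 1)) = t := add_left_cancel e
      have := congrArg ZMod.val e'
      rw [ZMod.val_natCast_of_lt hs, ZMod.val_natCast_of_lt ht] at this
      omega
    · have e' : (s : ZMod (k + 1)) = (t + 1 : ℕ) := by
        push_cast
        exact add_left_cancel (e.trans (add_assoc _ _ _))
      rcases Nat.lt_or_ge (t + 1) (k + 1) with h | h
      · have := congrArg ZMod.val e'
        rw [ZMod.val_natCast_of_lt hs, ZMod.val_natCast_of_lt h] at this
        omega
      · rw [show t + 1 = k + 1 by omega, ZMod.natCast_self] at e'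
        rw [e', add_zero] at hsA
        exact hg (by simpa using hsA)
  have hmem : ∀ x, x ∈ L ↔ x ∈ A := by
    intro x
    simp only [L, List.mem_filter, List.mem_map, List.mem_range, decide_eq_true_eq,
      and_iff_right_iff_imp]
    exact fun _ => ⟨(x - gate k A).val, ZMod.val_lt _, by simp⟩
  refine ⟨hinc, ?_, hmem⟩
  have hnodup : L.Nodup := List.Pairwise.imp (fun h => h.1) hinc
  rw [← List.toFinset_card_of_nodup hnodup]
  congr 1
  ext x
  rw [List.mem_toFinset, hmem]

theorem exists_word_uElt {B : Finset (ZMod (k + 1))} (hB : B ≠ Finset.univ) :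
    ∃ U : List (ZMod (k + 1)), IsIncreasingWord U ∧ U.length = B.card ∧ (∀ x, x ∈ U ↔ x ∈ B) ∧
      uElt k B = wordProd k U := by
  obtain ⟨h1, h2, h3⟩ := exists_gate_word hB
  exact ⟨_, h1, h2, h3, rfl⟩

theorem exists_word_dElt {A : Finset (ZMod (k + 1))} (hA : A ≠ Finset.univ) :
    ∃ L : List (ZMod (k + 1)), IsDecreasingWord L ∧ L.length = A.card ∧ (∀ x, x ∈ L ↔ x ∈ A) ∧
      dElt k A = wordProd k L := by
  obtain ⟨h1, h2, h3⟩ := exists_gate_word hA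
  refine ⟨_, List.pairwise_reverse.mpr h1, by rw [List.length_reverse, h2], fun x => by
    rw [List.mem_reverse, h3], ?_⟩
  rw [dElt, wordProd, List.map_reverse, List.filter_reverse]

end Elements

section Main

variable {k : ℕ} {A B : Finset (ZMod (k + 1))} {L U : List (ZMod (k + 1))}

theorem mem_rightDescents_mul_iff (hk : 1 ≤ k) (U L : List (ZMod (k + 1))) (j : ℤ) :
    (j : ZMod (k + 1)) ∈ rightDescents k (wordProd k U * wordProd k L) ↔
      wordProd k U (wordProd k L (j + 1)) < wordProd k U (wordProd k L j) := by
  rw [← wordProd_append, mem_rightDescents_iff hk, wordProd_append]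
  rfl

theorem IsDecreasingWord.rightDescents_subset_iff (hk : 1 ≤ k) (hL : IsDecreasingWord L)
    (hLA : ∀ x, x ∈ L ↔ x ∈ A) (i : ZMod (k + 1)) :
    rightDescents k (wordProd k L) ⊆ {i} ↔ ∀ y ∈ A, y ≠ i → y - 1 ∈ A := by
  have key : ∀ y, y ∈ rightDescents k (wordProd k L) ↔ y ∈ A ∧ y - 1 ∉ A := by
    intro y
    obtain ⟨j, rfl⟩ := ZMod.intCast_surjective y
    rw [mem_rightDescents_iff hk, hL.descent_iff hk, hLA, hLA]
  constructor
  · intro h y hy hyi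
    by_contra hc
    exact hyi (h ((key y).mpr ⟨hy, hc⟩))
  · intro h y hy
    obtain ⟨h1, h2⟩ := (key y).mp hy
    by_contra hc
    exact h2 (h y h1 hc)

theorem IsIncreasingWord.rightDescents_subset_iff (hk : 1 ≤ k) (hU : IsIncreasingWord U)
    (hUB : ∀ x, x ∈ U ↔ x ∈ B) (i : ZMod (k + 1)) :
    rightDescents k (wordProd k U) ⊆ {i} ↔ ∀ y ∈ B, y ≠ i → y + 1 ∈ B := by
  have key : ∀ y, y ∈ rightDescents k (wordProd k U) ↔ y ∈ B ∧ y + 1 ∉ B := by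
    intro y
    obtain ⟨j, rfl⟩ := ZMod.intCast_surjective y
    rw [mem_rightDescents_iff hk, hU.descent_iff hk, hUB, hUB]
  constructor
  · intro h y hy hyi
    by_contra hc
    exact hyi (h ((key y).mpr ⟨hy, hc⟩))
  · intro h y hy
    obtain ⟨h1, h2⟩ := (key y).mp hy
    by_contra hc
    exact h2 (h y h1 hc)

theorem mem_or_mem_of_card {i : ZMod (k + 1)} (hsize : k + 1 ≤ A.card + B.card)
    (hA : ∀ y ∈ A, y ≠ i → y - 1 ∈ A) (hB : ∀ y ∈ B, y ≠ i - 1 → y + 1 ∈ B)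
    (j : ZMod (k + 1)) : j ∈ A ∨ j ∈ B := by
  by_contra! hc
  have hdisj : Disjoint A B := by
    rw [Finset.disjoint_left]
    intro x hxA hxB
    rcases le_total (j - i).val (x - i).val with h | h
    · exact hc.1 (mem_of_val_sub_le (S := (A : Set (ZMod (k + 1)))) hA hxA h)
    · exact hc.2 (mem_of_le_val_sub (S := (B : Set (ZMod (k + 1)))) hB hxB h)
  have := card_add_card_le hdisj hc.1 hc.2
  omega

theorem rightDescents_mul_subset (hk : 1 ≤ k) {i : ZMod (k + 1)} (hL : IsDecreasingWord L)
    (hU : IsIncreasingWord U) (hLA : ∀ x, x ∈ L ↔ x ∈ A) (hUB : ∀ x, x ∈ U ↔ x ∈ B)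
    (hcover : ∀ x, x ∉ A → x ∈ B)
    (hA : ∀ y ∈ A, y ≠ i → y - 1 ∈ A) (hB : ∀ y ∈ B, y ≠ i - 1 → y + 1 ∈ B) :
    rightDescents k (wordProd k U * wordProd k L) ⊆ {i} := by
  intro y hy
  by_contra hyi
  rw [Set.mem_singleton_iff] at hyi
  obtain ⟨j, rfl⟩ := ZMod.intCast_surjective y
  rw [mem_rightDescents_mul_iff hk] at hy
  have hdesc : ∀ r : ℤ, (r : ZMod (k + 1)) ≠ i - 1 → ¬ wordProd k U (r + 1) < wordProd k U r := by
    intro r hr h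
    rw [hU.descent_iff hk, hUB, hUB] at h
    exact h.2 (hB _ h.1 hr)
  by_cases hjA : (j : ZMod (k + 1)) ∈ A
  · have hj1 := hA _ hjA hyi
    rw [hL.apply_of_mem hk ((hLA _).mpr hjA)] at hy
    have e := hL.apply_of_mem hk (j := j - 1) (by push_cast; exact (hLA _).mpr hj1)
    rw [sub_add_cancel] at e
    rw [e] at hy
    refine hdesc (j - 1) ?_ (by rwa [sub_add_cancel])
    push_cast
    exact fun e => hyi (sub_left_injective e)
  · have hd : wordProd k L j ≤ j := wordProd_le_self hk L (by rwa [hLA])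
    by_cases hj1 : (j : ZMod (k + 1)) + 1 = i
    · have hv := self_le_wordProd hk L (j := j + 1) (by push_cast; simpa [hLA] using hjA)
      have hvA : (wordProd k L (j + 1) : ZMod (k + 1)) ∉ A := by
        intro h
        have := (wordProd k L).injective (hL.apply_of_mem hk ((hLA _).mpr h))
        omega
      rw [hU.apply_of_mem hk ((hUB _).mpr (hcover _ hvA))] at hy
      have := hU.apply_le hk (wordProd k L j)
      omega
    · have hj1A : (j : ZMod (k + 1)) + 1 ∉ A := fun h => hjA (by simpa using hA _ h hj1)
      have hji : (j : ZMod (k + 1)) ≠ i - 1 := fun e => hj1 (by rw [e, sub_add_cancel])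
      rw [wordProd_of_not_mem hk L (j := j + 1) (by push_cast; rwa [hLA])
        (by push_cast; simpa [hLA] using hjA)] at hy
      by_cases hj2 : (j : ZMod (k + 1)) - 1 ∈ A
      · have e := hL.apply_of_mem hk (j := j - 1) (by push_cast; exact (hLA _).mpr hj2)
        rw [sub_add_cancel] at e
        rw [e, hU.apply_of_mem hk (j := j + 1) (by
          push_cast; exact (hUB _).mpr (hB _ (hcover _ hjA) hji))] at hy
        have := hU.apply_le hk (j - 1)
        omega
      · rw [wordProd_of_not_mem hk L (by rwa [hLA]) (by rwa [hLA])] at hy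
        exact hdesc j hji hy

theorem rightDescents_subset_mul (U L : List (ZMod (k + 1)))
    (hred : U.length + L.length ≤ affLen k (wordProd k U * wordProd k L)) :
    rightDescents k (wordProd k L) ⊆ rightDescents k (wordProd k U * wordProd k L) := by
  intro y hy
  have h1 : affLen k (wordProd k L * sAff k y) < affLen k (wordProd k L) := hy
  change affLen k (wordProd k U * wordProd k L * sAff k y) < _
  have h2 := affLen_wordProd_le k L
  have h3 := affLen_wordProd_le k U
  have h4 := affLen_wordProd_mul_le k U (L ++ [y])
  rw [wordProd_concat, ← mul_assoc] at h4
  omega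

theorem add_one_mem_of_dominant (hk : 1 ≤ k) {i : ZMod (k + 1)} (hL : IsDecreasingWord L)
    (hU : IsIncreasingWord U) (hLA : ∀ x, x ∈ L ↔ x ∈ A) (hUB : ∀ x, x ∈ U ↔ x ∈ B)
    (hAuniv : A ≠ Finset.univ) (hsize : k + 1 ≤ A.card + B.card) (hi : i ∈ A)
    (hA : ∀ y ∈ A, y ≠ i → y - 1 ∈ A)
    (hred : U.length + L.length ≤ affLen k (wordProd k U * wordProd k L))
    (hdom : rightDescents k (wordProd k U * wordProd k L) ⊆ {i}) :
    ∀ y ∈ B, y ≠ i - 1 → y + 1 ∈ B := by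
  have hdom' : ∀ r : ℤ, (r : ZMod (k + 1)) ≠ i →
      ¬ wordProd k U (wordProd k L (r + 1)) < wordProd k U (wordProd k L r) := by
    intro r hr h
    rw [← mem_rightDescents_mul_iff hk] at h
    exact hr (hdom h)
  have hi1 : i - 1 ∉ A := by
    intro h
    refine hAuniv (Finset.eq_univ_iff_forall.mpr fun y => ?_)
    refine mem_of_val_sub_le (S := (A : Set (ZMod (k + 1)))) hA h ?_
    have hv := val_neg_one_sub (0 : ZMod (k + 1))
    have hy := ZMod.val_lt (y - i)
    rw [sub_zero, ZMod.val_zero] at hv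
    rw [show i - 1 - i = -1 by ring, hv]
    omega
  have hinter : ∀ y ∈ A, y ∈ B → y + 1 ∈ B := by
    intro y hyA hyB
    by_contra hc
    obtain ⟨j, rfl⟩ := ZMod.intCast_surjective y
    have hdesc : wordProd k U (j + 1) < wordProd k U j := by
      rw [hU.descent_iff hk, hUB, hUB]
      exact ⟨hyB, hc⟩
    by_cases hj1 : (j : ZMod (k + 1)) + 1 ∈ A
    · refine hdom' (j + 1) ?_ ?_
      · push_cast
        exact fun e => hi1 (by rw [← e]; simpa using hyA)
      · rw [hL.apply_of_mem hk (j := j + 1) (by push_cast; rwa [hLA]),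
          hL.apply_of_mem hk ((hLA _).mpr hyA)]
        exact hdesc
    · have := affLen_mul_lt_of_descent hk hdesc hL (by rwa [hLA]) (by rwa [hLA])
      omega
  intro y hyB hyi
  by_contra hc
  have hyA : y ∉ A := fun h => hc (hinter y h hyB)
  have hy1A : y + 1 ∉ A := fun h => hyA (by
    simpa using hA _ h fun e => hyi (by rw [← e, add_sub_cancel_right]))
  have hyni : y ≠ i := fun e => hyA (e ▸ hi)
  obtain ⟨j, rfl⟩ := ZMod.intCast_surjective y
  have hdesc : wordProd k U (j + 1) < wordProd k U j := by
    rw [hU.descent_iff hk, hUB, hUB]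
    exact ⟨hyB, hc⟩
  have hj := hdom' j hyni
  rw [wordProd_of_not_mem hk L (j := j + 1) (by push_cast; rwa [hLA])
    (by push_cast; simpa [hLA] using hyA)] at hj
  by_cases hj1A : (j : ZMod (k + 1)) - 1 ∈ A
  · have e := hL.apply_of_mem hk (j := j - 1) (by push_cast; exact (hLA _).mpr hj1A)
    rw [sub_add_cancel] at e
    rw [e] at hj
    have hj1B : (j : ZMod (k + 1)) - 1 ∉ B := by
      intro h
      have e1 := hU.apply_of_mem hk (j := j - 1) (by push_cast; exact (hUB _).mpr h)
      have e2 := hU.apply_of_mem hk ((hUB _).mpr hyB)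
      have hne : wordProd k U (j + 1) ≠ wordProd k U (j - 1) := fun e => by
        have := (wordProd k U).injective e
        omega
      omega
    have hdisj : Disjoint A B := by
      rw [Finset.disjoint_iff_inter_eq_empty]
      by_contra hne
      obtain ⟨x, hx, hx1⟩ := exists_mem_add_one_not_mem (Finset.nonempty_iff_ne_empty.mpr hne)
        fun e => hyA (Finset.mem_inter.mp (e ▸ Finset.mem_univ (j : ZMod (k + 1)))).1
      obtain ⟨hxA, hxB⟩ := Finset.mem_inter.mp hx
      have hx1A : x + 1 ∉ A := fun h => hx1 (Finset.mem_inter.mpr ⟨h, hinter x hxA hxB⟩)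
      have := upper_end_unique hi hA hxA hx1A hj1A (by rwa [sub_add_cancel])
      exact hj1B (this ▸ hxB)
    have := card_add_card_le hdisj hy1A hc
    omega
  · rw [wordProd_of_not_mem hk L (by rwa [hLA]) (by rwa [hLA])] at hj
    exact hj hdesc

end Main

end AffineDominant

/-- for `|A| + |B| ≥ k + 1`, `u_B d_A` is reduced and `i`-dominant iff
`d_A` is `i`-dominant and `u_B` is `(i−1)`-dominant. -/
theorem up_down_dominant_iff (k : ℕ) (hk : 1 ≤ k) (A B : Finset (ZMod (k + 1)))
    (hA : A ≠ Finset.univ) (hB : B ≠ Finset.univ)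
    (hsize : k + 1 ≤ A.card + B.card) (i : ZMod (k + 1)) :
    (affLen k (uElt k B * dElt k A) = A.card + B.card ∧
        rightDescents k (uElt k B * dElt k A) ⊆ {i}) ↔
      (rightDescents k (dElt k A) ⊆ {i} ∧
        rightDescents k (uElt k B) ⊆ {i - 1}) := by
  obtain ⟨L, hL, hLlen, hLA, eL⟩ := AffineDominant.exists_word_dElt hA
  obtain ⟨U, hU, hUlen, hUB, eU⟩ := AffineDominant.exists_word_uElt hB
  rw [eL, eU, hL.rightDescents_subset_iff hk hLA, hU.rightDescents_subset_iff hk hUB]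
  have hmem : (∀ y ∈ A, y ≠ i → y - 1 ∈ A) → i ∈ A := by
    intro h
    have hBcard := (Finset.card_lt_iff_ne_univ B).mpr hB
    rw [ZMod.card] at hBcard
    obtain ⟨x, hx⟩ : A.Nonempty := Finset.card_pos.mp (by omega)
    exact AffineDominant.mem_of_val_sub_le (S := (A : Set (ZMod (k + 1)))) h hx (by simp)
  constructor
  · rintro ⟨hlen, hdom⟩
    have hred : U.length + L.length ≤
        affLen k (AffineDominant.wordProd k U * AffineDominant.wordProd k L) := by omega
    have hA' := (hL.rightDescents_subset_iff hk hLA i).mp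
      ((AffineDominant.rightDescents_subset_mul U L hred).trans hdom)
    exact ⟨hA', AffineDominant.add_one_mem_of_dominant hk hL hU hLA hUB hA hsize (hmem hA') hA'
      hred hdom⟩
  · rintro ⟨hA', hB'⟩
    have hcover : ∀ x, x ∉ A → x ∈ B := fun x hx =>
      (AffineDominant.mem_or_mem_of_card hsize hA' hB' x).resolve_left hx
    refine ⟨le_antisymm ?_ ?_, AffineDominant.rightDescents_mul_subset hk hL hU hLA hUB hcover
      hA' hB'⟩
    · rw [← AffineDominant.wordProd_append]
      refine (AffineDominant.affLen_wordProd_le k (U ++ L)).trans ?_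
      rw [List.length_append]
      omega
    · have h1 := AffineDominant.affLen_add_length_le hk hU hL fun x hx => by
        rw [hLA] at hx
        exact (hUB x).mpr (hcover x hx)
      have h2 := hU.length_le_affLen hk
      omega
end
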